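/- Let N ≥ 2 and p ∈ (1, p_N). For every λ ≥ 0, problem (P)_λ on the unit-volume ball 𝔻_N admits exactly one solution: there exists a solution (α_λ, ψ_λ), and any two solutions of (P)_λ on 𝔻_N coincide. -/

import Mathlib

open MeasureTheory Metric Set

noncomputable section

/-- The Laplacian of a function on Euclidean space. -/
def lapl {N : ℕ} (f : EuclideanSpace ℝ (Fin N) → ℝ) (x : EuclideanSpace ℝ (Fin N)) : ℝ :=
  ∑ i : Fin N,
    fderiv ℝ (fun y => fderiv ℝ f y (EuclideanSpace.single i (1 : ℝ))) x
      (EuclideanSpace.single i (1 : ℝ))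

/-- `(α, ψ)` is a solution of problem `(P)_λ` on `Ω`:
`ψ ∈ C²`, `-Δψ = (max (α + λψ) 0)^p` in `Ω`, `ψ = 0` on `∂Ω`, and
`∫_Ω (max (α + λψ) 0)^p = 1`. -/
def IsSol {N : ℕ} (Ω : Set (EuclideanSpace ℝ (Fin N))) (p lam α : ℝ)
    (ψ : EuclideanSpace ℝ (Fin N) → ℝ) : Prop :=
  ContDiff ℝ 2 ψ ∧
  (∀ x ∈ Ω, -lapl ψ x = (max (α + lam * ψ x) 0) ^ p) ∧
  (∀ x ∈ frontier Ω, ψ x = 0) ∧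
  (∫ x in Ω, (max (α + lam * ψ x) 0) ^ p) = 1

/-- The radius `R_N` of the ball in `ℝ^N` centered at the origin with unit volume. -/
def RN (N : ℕ) : ℝ :=
  (volume (ball (0 : EuclideanSpace ℝ (Fin N)) 1)).toReal ^ (-(1 : ℝ) / (N : ℝ))

/-- `𝔻_N`: the open ball in `ℝ^N` centered at the origin with unit volume. -/
def DN (N : ℕ) : Set (EuclideanSpace ℝ (Fin N)) := ball 0 (RN N)

section Auxiliary

open Filter Topology InnerProductSpace

section Laplacian

variable {N : ℕ} {f g : EuclideanSpace ℝ (Fin N) → ℝ}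

theorem hasFDerivAt_fderiv_of_contDiff_two {F : Type*} [NormedAddCommGroup F] [NormedSpace ℝ F]
    {f : F → ℝ} (hf : ContDiff ℝ 2 f) (x : F) :
    HasFDerivAt (fderiv ℝ f) (fderiv ℝ (fderiv ℝ f) x) x :=
  ((hf.fderiv_right (m := 1) (by norm_num)).differentiable (by norm_num) x).hasFDerivAt

theorem differentiable_deriv_of_contDiff_two {q : ℝ → ℝ} (hq : ContDiff ℝ 2 q) :
    Differentiable ℝ (deriv q) :=
  (ContDiff.deriv' (n := 1) (by simpa [one_add_one_eq_two] using hq)).differentiable (by norm_num)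

theorem fderiv_fderiv_apply_const {F : Type*} [NormedAddCommGroup F] [NormedSpace ℝ F]
    {f : F → ℝ} (hf : ContDiff ℝ 2 f) (x v w : F) :
    fderiv ℝ (fun y => fderiv ℝ f y v) x w = fderiv ℝ (fderiv ℝ f) x w v := by
  have h := (hasFDerivAt_fderiv_of_contDiff_two hf x).clm_apply (hasFDerivAt_const v x)
  rw [h.fderiv]
  simp

theorem lapl_eq_sum (hf : ContDiff ℝ 2 f) (x : EuclideanSpace ℝ (Fin N)) :
    lapl f x = ∑ i : Fin N, fderiv ℝ (fderiv ℝ f) x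
      (EuclideanSpace.single i (1 : ℝ)) (EuclideanSpace.single i (1 : ℝ)) := by
  simp only [lapl, fderiv_fderiv_apply_const hf]

theorem lapl_eq_sum_orthonormalBasis (hf : ContDiff ℝ 2 f) (x : EuclideanSpace ℝ (Fin N))
    {ι : Type*} [Fintype ι] (b : OrthonormalBasis ι ℝ (EuclideanSpace ℝ (Fin N))) :
    lapl f x = ∑ i, fderiv ℝ (fderiv ℝ f) x (b i) (b i) := by
  have h1 := congrFun (laplacian_eq_iteratedFDeriv_orthonormalBasis f b) x
  have h2 := congrFun
    (laplacian_eq_iteratedFDeriv_orthonormalBasis f (EuclideanSpace.basisFun (Fin N) ℝ)) x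
  rw [lapl_eq_sum hf]
  simp only [iteratedFDeriv_two_apply] at h1 h2
  simpa using h2.symm.trans h1

theorem lapl_eq_laplacian (hf : ContDiff ℝ 2 f) (x : EuclideanSpace ℝ (Fin N)) :
    lapl f x = Laplacian.laplacian f x := by
  have h2 := congrFun
    (laplacian_eq_iteratedFDeriv_orthonormalBasis f (EuclideanSpace.basisFun (Fin N) ℝ)) x
  rw [h2, lapl_eq_sum hf]
  simp [iteratedFDeriv_two_apply]

theorem lapl_add (hf : ContDiff ℝ 2 f) (hg : ContDiff ℝ 2 g) (x : EuclideanSpace ℝ (Fin N)) :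
    lapl (fun y => f y + g y) x = lapl f x + lapl g x := by
  rw [lapl_eq_laplacian hf, lapl_eq_laplacian hg, lapl_eq_laplacian (hf.add hg)]
  exact hf.contDiffAt.laplacian_add hg.contDiffAt

theorem lapl_sub (hf : ContDiff ℝ 2 f) (hg : ContDiff ℝ 2 g) (x : EuclideanSpace ℝ (Fin N)) :
    lapl (fun y => f y - g y) x = lapl f x - lapl g x := by
  rw [lapl_eq_laplacian hf, lapl_eq_laplacian hg, lapl_eq_laplacian (hf.sub hg)]
  exact hf.contDiffAt.laplacian_sub hg.contDiffAt

theorem lapl_const_mul (c : ℝ) (hf : ContDiff ℝ 2 f) (x : EuclideanSpace ℝ (Fin N)) :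
    lapl (fun y => c * f y) x = c * lapl f x := by
  rw [lapl_eq_laplacian hf, lapl_eq_laplacian (contDiff_const.mul hf)]
  exact laplacian_smul (𝕜 := ℝ) c hf.contDiffAt

theorem lapl_const (c : ℝ) (x : EuclideanSpace ℝ (Fin N)) :
    lapl (fun _ => c) x = 0 := by
  simp [lapl]

/-- Second derivative of the composition with an affine map. -/
theorem fderiv_fderiv_comp_affine (hf : ContDiff ℝ 2 f)
    (L : EuclideanSpace ℝ (Fin N) →L[ℝ] EuclideanSpace ℝ (Fin N))
    (b x v w : EuclideanSpace ℝ (Fin N)) :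
    fderiv ℝ (fderiv ℝ (fun y => f (L y + b))) x v w
      = fderiv ℝ (fderiv ℝ f) (L x + b) (L v) (L w) := by
  have hs : ∀ x, HasFDerivAt (fun y => L y + b) L x := fun x => L.hasFDerivAt.add_const b
  have h1 : ∀ y, fderiv ℝ (fun y => f (L y + b)) y = (fderiv ℝ f (L y + b)).comp L := fun y =>
    ((hf.differentiable (by norm_num) _).hasFDerivAt.comp y (hs y)).fderiv
  have hc : ContDiff ℝ 2 (fun y => f (L y + b)) := by fun_prop
  rw [← fderiv_fderiv_apply_const hc]
  simp only [h1, ContinuousLinearMap.comp_apply]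
  have h2 := (((hasFDerivAt_fderiv_of_contDiff_two hf (L x + b)).comp x (hs x)).clm_apply
    (hasFDerivAt_const (L w) x))
  have h3 : fderiv ℝ (fun y => fderiv ℝ f (L y + b) (L w)) x = _ := h2.fderiv
  rw [h3]
  simp

theorem lapl_comp_isometry (hf : ContDiff ℝ 2 f)
    (L : EuclideanSpace ℝ (Fin N) ≃ₗᵢ[ℝ] EuclideanSpace ℝ (Fin N))
    (b x : EuclideanSpace ℝ (Fin N)) :
    lapl (fun y => f (L y + b)) x = lapl f (L x + b) := by
  have hL : ContDiff ℝ 2 (fun y => f (L y + b)) :=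
    hf.comp (L.toContinuousLinearEquiv.contDiff.add contDiff_const)
  rw [lapl_eq_sum hL, lapl_eq_sum_orthonormalBasis hf _
    ((EuclideanSpace.basisFun (Fin N) ℝ).map L)]
  refine Finset.sum_congr rfl fun i _ => ?_
  have := fderiv_fderiv_comp_affine hf
    (L.toContinuousLinearEquiv : EuclideanSpace ℝ (Fin N) →L[ℝ] EuclideanSpace ℝ (Fin N)) b x
    (EuclideanSpace.single i 1) (EuclideanSpace.single i 1)
  simpa using this

theorem lapl_comp_smul (hf : ContDiff ℝ 2 f) (c : ℝ) (x : EuclideanSpace ℝ (Fin N)) :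
    lapl (fun y => f (c • y)) x = c ^ 2 * lapl f (c • x) := by
  have hL : ContDiff ℝ 2 (fun y => f (c • y)) := by fun_prop
  rw [lapl_eq_sum hL, lapl_eq_sum hf, Finset.mul_sum]
  refine Finset.sum_congr rfl fun i _ => ?_
  have := fderiv_fderiv_comp_affine hf
    (c • ContinuousLinearMap.id ℝ (EuclideanSpace ℝ (Fin N))) 0 x
    (EuclideanSpace.single i 1) (EuclideanSpace.single i 1)
  simp only [_root_.smul_apply, ContinuousLinearMap.id_apply, add_zero,
    map_smul, smul_eq_mul] at this
  rw [this]
  ring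

theorem hasFDerivAt_norm_sub_sq (c x : EuclideanSpace ℝ (Fin N)) :
    HasFDerivAt (fun y => ‖y - c‖ ^ 2) (2 • innerSL ℝ (x - c)) x := by
  have := ((hasFDerivAt_id x).sub_const c).norm_sq
  simpa using this

theorem hasFDerivAt_radial {q : ℝ → ℝ} (hq : Differentiable ℝ q)
    (c x : EuclideanSpace ℝ (Fin N)) :
    HasFDerivAt (fun y => q (‖y - c‖ ^ 2))
      (deriv q (‖x - c‖ ^ 2) • (2 • innerSL ℝ (x - c))) x :=
  (hq _).hasDerivAt.comp_hasFDerivAt x (hasFDerivAt_norm_sub_sq c x)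

theorem contDiff_radial {q : ℝ → ℝ} (hq : ContDiff ℝ 2 q) (c : EuclideanSpace ℝ (Fin N)) :
    ContDiff ℝ 2 (fun y : EuclideanSpace ℝ (Fin N) => q (‖y - c‖ ^ 2)) :=
  hq.comp ((contDiff_id.sub contDiff_const).norm_sq ℝ)

theorem lapl_radial {q : ℝ → ℝ} (hq : ContDiff ℝ 2 q) (c x : EuclideanSpace ℝ (Fin N)) :
    lapl (fun y => q (‖y - c‖ ^ 2)) x
      = 4 * ‖x - c‖ ^ 2 * deriv (deriv q) (‖x - c‖ ^ 2) + 2 * N * deriv q (‖x - c‖ ^ 2) := by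
  have hq1 : Differentiable ℝ q := hq.differentiable (by norm_num)
  have hq2 : Differentiable ℝ (deriv q) := differentiable_deriv_of_contDiff_two hq
  have key : ∀ i : Fin N, fderiv ℝ (fun y => fderiv ℝ (fun y => q (‖y - c‖ ^ 2)) y
      (EuclideanSpace.single i (1 : ℝ))) x (EuclideanSpace.single i (1 : ℝ))
      = 4 * deriv (deriv q) (‖x - c‖ ^ 2) * ((x - c) i) ^ 2 + 2 * deriv q (‖x - c‖ ^ 2) := by
    intro i
    have h1 : ∀ y, fderiv ℝ (fun y => q (‖y - c‖ ^ 2)) y (EuclideanSpace.single i (1 : ℝ))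
        = deriv q (‖y - c‖ ^ 2) * (2 * (EuclideanSpace.proj i : _ →L[ℝ] ℝ) (y - c)) := by
      intro y
      rw [(hasFDerivAt_radial hq1 c y).fderiv]
      simp [innerSL_apply_apply, EuclideanSpace.inner_single_right]
    simp only [h1]
    have h2 := (hasFDerivAt_radial hq2 c x).mul
      ((((EuclideanSpace.proj i : EuclideanSpace ℝ (Fin N) →L[ℝ] ℝ).hasFDerivAt (x := x - c)).comp
        x ((hasFDerivAt_id x).sub_const c)).const_mul 2)
    have h3 : fderiv ℝ (fun y => deriv q (‖y - c‖ ^ 2) *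
      (2 * (EuclideanSpace.proj i : _ →L[ℝ] ℝ) (y - c))) x = _ := h2.fderiv
    rw [h3]
    simp [innerSL_apply_apply, EuclideanSpace.inner_single_right]
    ring
  simp only [lapl, key]
  rw [Finset.sum_add_distrib, ← Finset.mul_sum, ← EuclideanSpace.real_norm_sq_eq]
  simp
  ring

end Laplacian

section MaximumPrinciple

variable {N : ℕ} {f : EuclideanSpace ℝ (Fin N) → ℝ}

theorem deriv_deriv_nonneg_of_isLocalMin {φ : ℝ → ℝ} {t : ℝ} (h : IsLocalMin φ t)
    (hc : ContinuousAt φ t) : 0 ≤ deriv (deriv φ) t := by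
  by_contra! hneg
  have hmax := isLocalMax_of_deriv_deriv_neg hneg h.deriv_eq_zero hc
  have heq : φ =ᶠ[𝓝 t] fun _ => φ t := by
    filter_upwards [h, hmax] with s h1 h2 using le_antisymm h2 h1
  have : deriv (deriv φ) t = 0 := by
    rw [heq.deriv.deriv_eq]
    simp
  exact hneg.ne this

theorem deriv_line {F : Type*} [NormedAddCommGroup F] [NormedSpace ℝ F] {f : F → ℝ}
    (hf : Differentiable ℝ f) (x v : F) (t : ℝ) :
    HasDerivAt (fun s : ℝ => f (x + s • v)) (fderiv ℝ f (x + t • v) v) t := by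
  have h1 : HasDerivAt (fun s : ℝ => x + s • v) v t := by
    simpa using ((hasDerivAt_id t).smul_const v).const_add x
  exact (hf _).hasFDerivAt.comp_hasDerivAt t h1

theorem deriv_deriv_line {F : Type*} [NormedAddCommGroup F] [NormedSpace ℝ F] {f : F → ℝ}
    (hf : ContDiff ℝ 2 f) (x v : F) (t : ℝ) :
    HasDerivAt (fun s : ℝ => fderiv ℝ f (x + s • v) v)
      (fderiv ℝ (fderiv ℝ f) (x + t • v) v v) t := by
  have h := deriv_line (f := fun y => fderiv ℝ f y v)
    (fun y => ((hasFDerivAt_fderiv_of_contDiff_two hf y).clm_apply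
      (hasFDerivAt_const v y)).differentiableAt) x v t
  rwa [fderiv_fderiv_apply_const hf] at h

theorem lapl_nonneg_of_isLocalMin (hf : ContDiff ℝ 2 f) {x : EuclideanSpace ℝ (Fin N)}
    (h : IsLocalMin f x) : 0 ≤ lapl f x := by
  rw [lapl_eq_sum hf]
  refine Finset.sum_nonneg fun i _ => ?_
  set v : EuclideanSpace ℝ (Fin N) := EuclideanSpace.single i 1
  have hd := hf.differentiable (by norm_num)
  have h1 : deriv (fun s : ℝ => f (x + s • v)) = fun t => fderiv ℝ f (x + t • v) v :=
    funext fun t => (deriv_line hd x v t).deriv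
  have h2 := (deriv_deriv_line hf x v 0).deriv
  rw [← h1] at h2
  simp only [zero_smul, add_zero] at h2
  rw [← h2]
  have hcont : Continuous fun s : ℝ => x + s • v := by fun_prop
  refine deriv_deriv_nonneg_of_isLocalMin ?_ (deriv_line hd x v 0).continuousAt
  have ht : Tendsto (fun s : ℝ => x + s • v) (𝓝 0) (𝓝 x) := by
    simpa using hcont.tendsto 0
  have := ht.eventually h
  simpa [IsLocalMin, IsMinFilter] using this

/-- Weak minimum principle for superharmonic functions. -/
theorem nonneg_of_lapl_nonpos (hf : ContDiff ℝ 2 f) (hN : N ≠ 0)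
    {U : Set (EuclideanSpace ℝ (Fin N))}
    (hU : IsOpen U) (hb : Bornology.IsBounded U) (hl : ∀ x ∈ U, lapl f x ≤ 0)
    (hbd : ∀ x ∈ frontier U, 0 ≤ f x) : ∀ x ∈ closure U, 0 ≤ f x := by
  obtain ⟨C, hC⟩ := hb.closure.exists_norm_le
  have hK : IsCompact (closure U) := hb.isCompact_closure
  have key : ∀ ε > 0, ∀ x ∈ closure U, 0 ≤ f x + ε * (C ^ 2 - ‖x‖ ^ 2) := by
    intro ε hε
    set g : EuclideanSpace ℝ (Fin N) → ℝ := fun x => f x + ε * (C ^ 2 - ‖x - 0‖ ^ 2) with hg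
    have hq : ContDiff ℝ 2 (fun s : ℝ => ε * (C ^ 2 - s)) := by fun_prop
    have hgc : ContDiff ℝ 2 g := hf.add (contDiff_radial hq 0)
    have hlg : ∀ x ∈ U, lapl g x < 0 := by
      intro x hx
      have h1 : lapl g x = lapl f x + lapl (fun y => ε * (C ^ 2 - ‖y - 0‖ ^ 2)) x :=
        lapl_add hf (contDiff_radial hq 0) x
      have hd : deriv (fun s : ℝ => ε * (C ^ 2 - s)) = fun _ => -ε := by
        funext s
        simp
      have h2 := lapl_radial hq 0 x
      rw [hd] at h2
      simp only [deriv_const, mul_zero, zero_add] at h2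
      rw [h1, h2]
      have hN' : (0 : ℝ) < N := by exact_mod_cast Nat.pos_of_ne_zero hN
      have := hl x hx
      nlinarith [mul_pos hN' hε]
    intro x hx
    obtain ⟨m, hm, hmin⟩ := hK.exists_isMinOn ⟨x, hx⟩ hgc.continuous.continuousOn
    have hgm : 0 ≤ g m := by
      by_cases hmU : m ∈ U
      · have hloc : IsLocalMin g m :=
          hmin.isLocalMin (mem_of_superset (hU.mem_nhds hmU) subset_closure)
        exact absurd (lapl_nonneg_of_isLocalMin hgc hloc) (hlg m hmU).not_ge
      · have hmf : m ∈ frontier U := by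
          rw [hU.frontier_eq]
          exact ⟨hm, hmU⟩
        have h1 := hbd m hmf
        have h2 := hC m hm
        have h3 : ‖m‖ ^ 2 ≤ C ^ 2 := by gcongr
        simp only [hg, sub_zero]
        have : 0 ≤ ε * (C ^ 2 - ‖m‖ ^ 2) := mul_nonneg hε.le (by linarith)
        linarith
    have := hgm.trans (hmin hx)
    simpa [hg] using this
  intro x hx
  have ht : Tendsto (fun ε : ℝ => f x + ε * (C ^ 2 - ‖x‖ ^ 2)) (𝓝[>] 0) (𝓝 (f x)) := by
    have : Continuous fun ε : ℝ => f x + ε * (C ^ 2 - ‖x‖ ^ 2) := by fun_prop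
    simpa using (this.tendsto 0).mono_left nhdsWithin_le_nhds
  exact ge_of_tendsto ht (by filter_upwards [self_mem_nhdsWithin] with ε hε using key ε hε x hx)

/-- Hopf boundary lemma for superharmonic functions on a ball. -/
theorem hopf_lemma (hf : ContDiff ℝ 2 f) (hN : N ≠ 0) {c x₀ v : EuclideanSpace ℝ (Fin N)} {ρ : ℝ}
    (hρ : 0 < ρ) (hl : ∀ x ∈ ball c ρ, lapl f x ≤ 0) (hpos : ∀ x ∈ ball c ρ, 0 < f x)
    (hx₀ : ‖x₀ - c‖ = ρ) (h0 : f x₀ = 0) (hv : ⟪c - x₀, v⟫_ℝ > 0) :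
    0 < fderiv ℝ f x₀ v := by
  have hN' : (0 : ℝ) < N := by exact_mod_cast Nat.pos_of_ne_zero hN
  set a : ℝ := 2 * N / ρ ^ 2 with ha
  have hapos : 0 < a := by positivity
  -- the barrier
  set q : ℝ → ℝ := fun s => Real.exp (-a * s) - Real.exp (-a * ρ ^ 2) with hqdef
  have hq : ContDiff ℝ 2 q := by fun_prop
  have hq1 : deriv q = fun s => -a * Real.exp (-a * s) := by
    funext s
    have : HasDerivAt q (Real.exp (-a * s) * (-a * 1)) s :=
      (((hasDerivAt_id s).const_mul (-a)).exp).sub_const _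
    rw [this.deriv]
    ring
  have hq2 : deriv (deriv q) = fun s => a ^ 2 * Real.exp (-a * s) := by
    rw [hq1]
    funext s
    have : HasDerivAt (fun s => -a * Real.exp (-a * s)) (-a * (Real.exp (-a * s) * (-a * 1))) s :=
      (((hasDerivAt_id s).const_mul (-a)).exp).const_mul _
    rw [this.deriv]
    ring
  set h : EuclideanSpace ℝ (Fin N) → ℝ := fun y => q (‖y - c‖ ^ 2) with hh
  have hhc : ContDiff ℝ 2 h := contDiff_radial hq c
  have hlh : ∀ x, ρ / 2 ≤ ‖x - c‖ → 0 ≤ lapl h x := by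
    intro x hx
    rw [hh, lapl_radial hq, hq2, hq1]
    have h1 : ρ ^ 2 / 4 ≤ ‖x - c‖ ^ 2 := by nlinarith
    have h2 : 2 * N ≤ 4 * a * ‖x - c‖ ^ 2 := by
      have : 4 * a * (ρ ^ 2 / 4) = 2 * N := by
        rw [ha]; field_simp
      have := mul_le_mul_of_nonneg_left h1 (by positivity : 0 ≤ 4 * a)
      linarith
    have h3 := Real.exp_pos (-a * ‖x - c‖ ^ 2)
    have : 4 * ‖x - c‖ ^ 2 * (a ^ 2 * Real.exp (-a * ‖x - c‖ ^ 2)) +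
        2 * N * (-a * Real.exp (-a * ‖x - c‖ ^ 2))
        = (4 * a * ‖x - c‖ ^ 2 - 2 * N) * (a * Real.exp (-a * ‖x - c‖ ^ 2)) := by ring
    rw [this]
    exact mul_nonneg (by linarith) (by positivity)
  -- lower bound on the inner sphere
  obtain ⟨m, hm, hmle⟩ : ∃ m > 0, ∀ x, ‖x - c‖ = ρ / 2 → m ≤ f x := by
    rcases (sphere c (ρ / 2)).eq_empty_or_nonempty with he | hne
    · refine ⟨1, one_pos, fun x hx => ?_⟩
      have : x ∈ sphere c (ρ / 2) := by simpa [dist_eq_norm] using hx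
      simp [he] at this
    · obtain ⟨z, hz, hmin⟩ := (isCompact_sphere c (ρ / 2)).exists_isMinOn hne
        hf.continuous.continuousOn
      refine ⟨f z, hpos z ?_, fun x hx => hmin (by simpa [dist_eq_norm] using hx)⟩
      rw [mem_sphere] at hz
      rw [mem_ball, hz]
      linarith
  set U : Set (EuclideanSpace ℝ (Fin N)) := ball c ρ ∩ (closedBall c (ρ / 2))ᶜ with hU
  have hUo : IsOpen U := isOpen_ball.inter isClosed_closedBall.isOpen_compl
  have hUb : Bornology.IsBounded U := isBounded_ball.subset inter_subset_left
  have hfr : ∀ x ∈ frontier U, (‖x - c‖ = ρ ∧ 0 ≤ f x) ∨ ‖x - c‖ = ρ / 2 := by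
    intro x hx
    have hxc : x ∈ closure U := frontier_subset_closure hx
    have h1 : x ∈ closedBall c ρ :=
      closure_ball_subset_closedBall (closure_mono inter_subset_left hxc)
    have h2 : ρ / 2 ≤ ‖x - c‖ := by
      have hcl : IsClosed {x : EuclideanSpace ℝ (Fin N) | ρ / 2 ≤ ‖x - c‖} :=
        isClosed_le continuous_const (by fun_prop)
      refine (closure_minimal (fun y hy => ?_) hcl) hxc
      have := hy.2
      simp only [mem_compl_iff, mem_closedBall, dist_eq_norm, not_le] at this
      exact this.le
    rw [mem_closedBall, dist_eq_norm] at h1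
    have h3 : x ∉ U := by
      rw [hUo.frontier_eq] at hx
      exact hx.2
    rcases h1.lt_or_eq with h4 | h4
    · rcases h2.lt_or_eq with h5 | h5
      · exact absurd ⟨by simpa [dist_eq_norm] using h4, by simpa [dist_eq_norm] using h5⟩ h3
      · exact Or.inr h5.symm
    · refine Or.inl ⟨h4, ?_⟩
      have hcl : IsClosed {x : EuclideanSpace ℝ (Fin N) | 0 ≤ f x} :=
        isClosed_le continuous_const hf.continuous
      exact closure_minimal (fun y hy => (hpos y hy.1).le) hcl hxc
  set ε : ℝ := m with hε
  have hcmp : ∀ x ∈ closure U, 0 ≤ f x - ε * h x := by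
    refine nonneg_of_lapl_nonpos (hf.sub (contDiff_const.mul hhc)) hN hUo hUb ?_ ?_
    · intro x hx
      rw [lapl_sub hf (contDiff_const.mul hhc), lapl_const_mul _ hhc]
      have h1 := hl x hx.1
      have h2 : 0 ≤ lapl h x := hlh x (by
        have := hx.2
        simp only [mem_compl_iff, mem_closedBall, dist_eq_norm, not_le] at this
        exact this.le)
      nlinarith
    · intro x hx
      rcases hfr x hx with ⟨h1, h2⟩ | h1
      · have : h x = 0 := by simp [hh, hqdef, h1]
        rw [this]
        linarith
      · have h2 := hmle x h1
        have h3 : h x ≤ 1 := by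
          have e1 : Real.exp (-a * ‖x - c‖ ^ 2) ≤ 1 := by
            rw [Real.exp_le_one_iff]
            nlinarith [sq_nonneg ‖x - c‖]
          have e2 := Real.exp_pos (-a * ρ ^ 2)
          simp only [hh, hqdef]
          linarith
        nlinarith
  -- compare derivatives at the boundary point
  by_contra! hle
  set φ : ℝ → ℝ := fun t => f (x₀ + t • v) - ε * h (x₀ + t • v) with hφ
  have hφd : HasDerivAt φ (fderiv ℝ f x₀ v - ε * fderiv ℝ h x₀ v) 0 := by
    have h1 := deriv_line (hf.differentiable (by norm_num)) x₀ v 0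
    have h2 := deriv_line (hhc.differentiable (by norm_num)) x₀ v 0
    simp only [zero_smul, add_zero] at h1 h2
    exact h1.sub (h2.const_mul ε)
  have hhd : 0 < fderiv ℝ h x₀ v := by
    rw [hh, (hasFDerivAt_radial (hq.differentiable (by norm_num)) c x₀).fderiv, hq1]
    have : ⟪x₀ - c, v⟫_ℝ < 0 := by
      rw [← neg_sub, inner_neg_left]
      linarith
    simp only [_root_.smul_apply, smul_eq_mul, innerSL_apply_apply, nsmul_eq_mul]
    have e := Real.exp_pos (-a * ‖x₀ - c‖ ^ 2)
    have := mul_pos (mul_pos hapos e) (neg_pos.2 this)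
    push_cast
    nlinarith
  have hneg : fderiv ℝ f x₀ v - ε * fderiv ℝ h x₀ v < 0 := by
    have := mul_pos hm hhd
    linarith
  -- the segment enters the annulus
  have hent : ∀ᶠ t in 𝓝[>] (0 : ℝ), x₀ + t • v ∈ U := by
    have e1 : ∀ᶠ t in 𝓝[>] (0 : ℝ), x₀ + t • v ∈ (closedBall c (ρ / 2))ᶜ := by
      have hcont : Continuous fun s : ℝ => x₀ + s • v := by fun_prop
      have : Tendsto (fun s : ℝ => x₀ + s • v) (𝓝[>] 0) (𝓝 x₀) := by
        simpa using (hcont.tendsto 0).mono_left nhdsWithin_le_nhds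
      refine this.eventually (isClosed_closedBall.isOpen_compl.mem_nhds ?_)
      simp only [mem_compl_iff, mem_closedBall, dist_eq_norm, hx₀, not_le]
      linarith
    have e2 : ∀ᶠ t in 𝓝[>] (0 : ℝ), t * ‖v‖ ^ 2 < 2 * ⟪c - x₀, v⟫_ℝ := by
      have hcont : Continuous fun s : ℝ => s * ‖v‖ ^ 2 := by fun_prop
      have : Tendsto (fun s : ℝ => s * ‖v‖ ^ 2) (𝓝[>] 0) (𝓝 0) := by
        simpa using (hcont.tendsto 0).mono_left nhdsWithin_le_nhds
      exact this.eventually_lt_const (by linarith)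
    filter_upwards [e1, e2, self_mem_nhdsWithin] with t h1 h2 h3
    refine ⟨?_, h1⟩
    rw [mem_ball, dist_eq_norm]
    have h4 : x₀ + t • v - c = t • v - (c - x₀) := by abel
    have h5 : ‖x₀ + t • v - c‖ ^ 2 < ρ ^ 2 := by
      rw [h4, norm_sub_sq_real, inner_smul_left, norm_smul, norm_sub_rev c x₀, hx₀, mul_pow,
        real_inner_comm]
      simp only [Real.norm_eq_abs, sq_abs, conj_trivial]
      have : (0 : ℝ) < t := h3
      nlinarith [mul_pos this (sub_pos.2 h2)]
    exact lt_of_pow_lt_pow_left₀ 2 hρ.le h5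
  have hφ0 : φ 0 = 0 := by
    simp [hφ, h0, hh, hqdef, hx₀]
  have hslope : Tendsto (slope φ 0) (𝓝[>] 0) (𝓝 (fderiv ℝ f x₀ v - ε * fderiv ℝ h x₀ v)) :=
    hφd.tendsto_slope.mono_left
      (nhdsWithin_mono (0 : ℝ) (fun t (ht : 0 < t) => ht.ne'))
  have hge : 0 ≤ fderiv ℝ f x₀ v - ε * fderiv ℝ h x₀ v := by
    refine ge_of_tendsto hslope ?_
    filter_upwards [hent, self_mem_nhdsWithin] with t h1 h2
    rw [slope_def_field, hφ0, sub_zero, sub_zero]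
    exact div_nonneg (hcmp _ (subset_closure h1)) (le_of_lt h2)
  linarith

/-- Strong minimum principle for superharmonic functions. -/
theorem pos_of_lapl_nonpos (hf : ContDiff ℝ 2 f) (hN : N ≠ 0)
    {U : Set (EuclideanSpace ℝ (Fin N))}
    (hU : IsOpen U) (hconn : IsPreconnected U) (hl : ∀ x ∈ U, lapl f x ≤ 0)
    (hnn : ∀ x ∈ U, 0 ≤ f x) {x₁ : EuclideanSpace ℝ (Fin N)} (hx₁ : x₁ ∈ U) (hf₁ : 0 < f x₁) :
    ∀ x ∈ U, 0 < f x := by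
  set V : Set (EuclideanSpace ℝ (Fin N)) := U ∩ {x | 0 < f x} with hV
  set Z : Set (EuclideanSpace ℝ (Fin N)) := interior (U ∩ {x | f x = 0}) with hZ
  have hVo : IsOpen V := hU.inter (isOpen_lt continuous_const hf.continuous)
  have hcover : U ⊆ V ∪ Z := by
    intro z hz
    rcases (hnn z hz).lt_or_eq with h | h
    · exact Or.inl ⟨hz, h⟩
    right
    obtain ⟨δ, hδ, hsub⟩ := Metric.isOpen_iff.1 hU z hz
    rw [hZ, mem_interior_iff_mem_nhds]
    refine Filter.mem_of_superset (ball_mem_nhds z (half_pos hδ)) fun y hy => ?_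
    have hyd : dist y z < δ / 2 := hy
    have hyU : y ∈ U := hsub (ball_subset_ball (by linarith) hy)
    refine ⟨hyU, ?_⟩
    by_contra hne
    have hypos : 0 < f y := lt_of_le_of_ne (hnn y hyU) (Ne.symm hne)
    -- nearest zero
    set K : Set (EuclideanSpace ℝ (Fin N)) := closedBall y (dist z y) ∩ {x | f x = 0} with hK
    have hKc : IsCompact K := (isCompact_closedBall _ _).inter_right
      (isClosed_eq hf.continuous continuous_const)
    obtain ⟨x₀, hx₀, hmin⟩ := hKc.exists_isMinOn ⟨z, by simp [hK, h.symm]⟩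
      (continuous_id.dist continuous_const : Continuous fun x => dist x y).continuousOn
    have hd1 : dist x₀ y ≤ dist z y := hx₀.1
    have hdz : dist z y < δ / 2 := by rwa [dist_comm]
    have hd0 : 0 < dist x₀ y := by
      rw [dist_pos]
      rintro rfl
      exact hypos.ne' hx₀.2
    have hballU : ∀ x, dist x y ≤ dist x₀ y → x ∈ U := fun x hx =>
      hsub (by
        have := dist_triangle x y z
        rw [mem_ball]
        rw [dist_comm z y] at hd1
        linarith)
    have hbpos : ∀ x ∈ ball y (dist x₀ y), 0 < f x := by
      intro x hx
      have hx' : dist x y < dist x₀ y := hx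
      refine lt_of_le_of_ne (hnn x (hballU x hx'.le)) fun h0 => ?_
      have : dist x₀ y ≤ dist x y := hmin ⟨mem_closedBall.2 (hx'.le.trans hd1), h0.symm⟩
      linarith
    have hx₀U := hballU x₀ le_rfl
    have hloc : IsLocalMin f x₀ := by
      filter_upwards [hU.mem_nhds hx₀U] with x hx
      rw [show f x₀ = 0 from hx₀.2]
      exact hnn x hx
    have hH := hopf_lemma hf hN (v := y - x₀) hd0
      (fun x hx => hl x (hballU x (le_of_lt hx))) hbpos (dist_eq_norm _ _).symm hx₀.2 (by
        rw [real_inner_self_eq_norm_sq, ← dist_eq_norm, dist_comm]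
        positivity)
    rw [hloc.fderiv_eq_zero] at hH
    simp at hH
  have hUV : U ⊆ V := by
    refine hconn.subset_left_of_subset_union hVo isOpen_interior ?_ hcover ⟨x₁, hx₁, hx₁, hf₁⟩
    rw [Set.disjoint_left]
    intro x hx hx'
    exact hx.2.ne' (interior_subset hx').2
  exact fun x hx => (hUV hx).2

end MaximumPrinciple

section MovingPlanes

variable {N : ℕ} {ψ : EuclideanSpace ℝ (Fin N) → ℝ}

/-- Reflection across the hyperplane `⟪x, e⟫ = μ`, for a unit vector `e`. -/
def planeRefl (e : EuclideanSpace ℝ (Fin N)) (μ : ℝ) (x : EuclideanSpace ℝ (Fin N)) :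
    EuclideanSpace ℝ (Fin N) :=
  x + (2 * (μ - ⟪x, e⟫_ℝ)) • e

theorem norm_planeRefl_sq {e : EuclideanSpace ℝ (Fin N)} (he : ‖e‖ = 1) (μ : ℝ)
    (x : EuclideanSpace ℝ (Fin N)) :
    ‖planeRefl e μ x‖ ^ 2 = ‖x‖ ^ 2 + 4 * (μ - ⟪x, e⟫_ℝ) * μ := by
  rw [planeRefl, norm_add_sq_real, inner_smul_right, norm_smul, he, mul_one, Real.norm_eq_abs,
    sq_abs]
  ring

theorem planeRefl_eq_reflection {e : EuclideanSpace ℝ (Fin N)} (he : ‖e‖ = 1) (μ : ℝ)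
    (x : EuclideanSpace ℝ (Fin N)) :
    planeRefl e μ x = (ℝ ∙ e)ᗮ.reflection x + (2 * μ) • e := by
  rw [Submodule.reflection_orthogonal_apply, Submodule.reflection_singleton_apply, planeRefl, he]
  rw [real_inner_comm x e]
  simp only [RCLike.ofReal_real_eq_id, id, one_pow, div_one, mul_sub, sub_smul, mul_smul, two_smul]
  abel

theorem continuous_planeRefl_uncurry (e : EuclideanSpace ℝ (Fin N)) :
    Continuous fun z : ℝ × EuclideanSpace ℝ (Fin N) => planeRefl e z.1 z.2 := by
  unfold planeRefl
  fun_prop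

theorem contDiff_comp_planeRefl (hψ : ContDiff ℝ 2 ψ) (e : EuclideanSpace ℝ (Fin N)) (μ : ℝ) :
    ContDiff ℝ 2 (fun x => ψ (planeRefl e μ x)) := by
  have hi : ContDiff ℝ 2 fun x : EuclideanSpace ℝ (Fin N) => ⟪x, e⟫_ℝ :=
    contDiff_id.inner ℝ contDiff_const
  unfold planeRefl
  fun_prop

theorem lapl_comp_planeRefl (hψ : ContDiff ℝ 2 ψ) {e : EuclideanSpace ℝ (Fin N)} (he : ‖e‖ = 1)
    (μ : ℝ) (x : EuclideanSpace ℝ (Fin N)) :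
    lapl (fun x => ψ (planeRefl e μ x)) x = lapl ψ (planeRefl e μ x) := by
  simp only [planeRefl_eq_reflection he]
  exact lapl_comp_isometry hψ _ _ x

theorem planeRefl_mem_ball {e : EuclideanSpace ℝ (Fin N)} (he : ‖e‖ = 1) {μ R : ℝ} (hR : 0 < R)
    (hμ : 0 ≤ μ) {x : EuclideanSpace ℝ (Fin N)} (hx : x ∈ ball 0 R) (hxe : μ ≤ ⟪x, e⟫_ℝ) :
    planeRefl e μ x ∈ ball 0 R := by
  rw [mem_ball_zero_iff] at hx ⊢
  refine lt_of_pow_lt_pow_left₀ 2 hR.le ?_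
  rw [norm_planeRefl_sq he]
  have : ‖x‖ ^ 2 < R ^ 2 := by gcongr
  nlinarith

theorem planeRefl_mem_ball_of_norm_eq {e : EuclideanSpace ℝ (Fin N)} (he : ‖e‖ = 1) {μ R : ℝ}
    (hR : 0 < R) (hμ : 0 < μ) {x : EuclideanSpace ℝ (Fin N)} (hx : ‖x‖ = R)
    (hxe : μ < ⟪x, e⟫_ℝ) : planeRefl e μ x ∈ ball 0 R := by
  rw [mem_ball_zero_iff]
  refine lt_of_pow_lt_pow_left₀ 2 hR.le ?_
  rw [norm_planeRefl_sq he, hx]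
  nlinarith

theorem lt_planeRefl_of_le (hN : N ≠ 0) (hψ : ContDiff ℝ 2 ψ) {F : ℝ → ℝ} (hF : Monotone F)
    {R : ℝ} (hR : 0 < R) (hl : ∀ x ∈ ball 0 R, -lapl ψ x = F (ψ x))
    (h0 : ∀ x, ‖x‖ = R → ψ x = 0) (hpos : ∀ x ∈ ball 0 R, 0 < ψ x)
    {e : EuclideanSpace ℝ (Fin N)} (he : ‖e‖ = 1) {μ : ℝ} (hμ : 0 < μ) (hμR : μ < R)
    (hP : ∀ x ∈ ball 0 R, μ < ⟪x, e⟫_ℝ → ψ x ≤ ψ (planeRefl e μ x)) :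
    ∀ x ∈ ball 0 R, μ < ⟪x, e⟫_ℝ → ψ x < ψ (planeRefl e μ x) := by
  set U : Set (EuclideanSpace ℝ (Fin N)) := ball 0 R ∩ {x | μ < ⟪x, e⟫_ℝ} with hU
  have hUo : IsOpen U := isOpen_ball.inter (isOpen_lt continuous_const (by fun_prop))
  have hUc : Convex ℝ U := by
    refine (convex_ball _ _).inter ?_
    refine convex_halfSpace_gt (f := fun x => ⟪x, e⟫_ℝ) ⟨fun x y => ?_, fun c x => ?_⟩ μ
    · exact inner_add_left _ _ _
    · simp [inner_smul_left]
  set w : EuclideanSpace ℝ (Fin N) → ℝ := fun x => ψ (planeRefl e μ x) - ψ x with hw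
  have hwc : ContDiff ℝ 2 w := (contDiff_comp_planeRefl hψ e μ).sub hψ
  have hlw : ∀ x ∈ U, lapl w x ≤ 0 := by
    intro x hx
    rw [hw, lapl_sub (contDiff_comp_planeRefl hψ e μ) hψ, lapl_comp_planeRefl hψ he]
    have h1 := hl x hx.1
    have h2 := hl _ (planeRefl_mem_ball he hR hμ.le hx.1 (le_of_lt hx.2))
    have h3 := hF (hP x hx.1 hx.2)
    linarith
  have hRe : ‖R • e‖ = R := by rw [norm_smul, he, mul_one, Real.norm_of_nonneg hR.le]
  have hin : ∀ t : ℝ, ⟪t • e, e⟫_ℝ = t := fun t => by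
    rw [inner_smul_left, real_inner_self_eq_norm_sq, he]; simp
  have hwR : 0 < w (R • e) := by
    simp only [hw, h0 _ hRe, sub_zero]
    exact hpos _ (planeRefl_mem_ball_of_norm_eq he hR hμ hRe (by rwa [hin]))
  obtain ⟨t, ht1, ht2, ht3⟩ : ∃ t : ℝ, 0 < w (t • e) ∧ t < R ∧ μ < t := by
    have hc : Continuous fun t : ℝ => w (t • e) := by
      have := hwc.continuous
      fun_prop
    have e1 : ∀ᶠ t in 𝓝[<] R, 0 < w (t • e) :=
      (hc.tendsto R).mono_left nhdsWithin_le_nhds |>.eventually_const_lt hwR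
    have e2 : ∀ᶠ t in 𝓝[<] R, μ < t := (eventually_gt_nhds hμR).filter_mono nhdsWithin_le_nhds
    obtain ⟨t, ht⟩ := (e1.and (e2.and self_mem_nhdsWithin)).exists
    exact ⟨t, ht.1, ht.2.2, ht.2.1⟩
  have htU : t • e ∈ U := by
    refine ⟨?_, by simpa [hin] using ht3⟩
    rw [mem_ball_zero_iff, norm_smul, he, mul_one, Real.norm_of_nonneg (hμ.trans ht3).le]
    exact ht2
  have := pos_of_lapl_nonpos hwc hN hUo hUc.isPreconnected hlw
    (fun x hx => sub_nonneg.2 (hP x hx.1 hx.2)) htU ht1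
  exact fun x hx hxe => sub_pos.1 (this x ⟨hx, hxe⟩)

theorem fderiv_neg_on_plane (hN : N ≠ 0) (hψ : ContDiff ℝ 2 ψ) {F : ℝ → ℝ} (hF : Monotone F)
    (hF0 : ∀ t, 0 ≤ F t)
    {R : ℝ} (hR : 0 < R) (hl : ∀ x ∈ ball 0 R, -lapl ψ x = F (ψ x))
    (h0 : ∀ x, ‖x‖ = R → ψ x = 0) (hpos : ∀ x ∈ ball 0 R, 0 < ψ x)
    {e : EuclideanSpace ℝ (Fin N)} (he : ‖e‖ = 1) {μ : ℝ} (hμ : 0 < μ)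
    (hP : ∀ x ∈ ball 0 R, μ < ⟪x, e⟫_ℝ → ψ x ≤ ψ (planeRefl e μ x))
    {x : EuclideanSpace ℝ (Fin N)} (hx : ‖x‖ ≤ R) (hxe : ⟪x, e⟫_ℝ = μ) :
    fderiv ℝ ψ x e < 0 := by
  rcases hx.lt_or_eq with hxR | hxR
  · have hμR : μ < R := by
      have := real_inner_le_norm x e
      rw [he, hxe] at this
      linarith
    have hlt := lt_planeRefl_of_le hN hψ hF hR hl h0 hpos he hμ hμR hP
    set w : EuclideanSpace ℝ (Fin N) → ℝ := fun x => ψ (planeRefl e μ x) - ψ x with hw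
    have hwc : ContDiff ℝ 2 w := (contDiff_comp_planeRefl hψ e μ).sub hψ
    set ρ : ℝ := (R - ‖x‖) / 2 with hρ
    have hρ0 : 0 < ρ := by rw [hρ]; linarith
    have hsub : ∀ y ∈ ball (x + ρ • e) ρ, y ∈ ball 0 R ∧ μ < ⟪y, e⟫_ℝ := by
      intro y hy
      rw [mem_ball, dist_eq_norm] at hy
      have hy2 : y = (y - (x + ρ • e)) + x + ρ • e := by abel
      constructor
      · rw [mem_ball_zero_iff, hy2]
        have h1 := norm_add₃_le (a := y - (x + ρ • e)) (b := x) (c := ρ • e)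
        rw [norm_smul, he, mul_one, Real.norm_of_nonneg hρ0.le] at h1
        have : ρ + ρ = R - ‖x‖ := by rw [hρ]; ring
        linarith
      · have h1 := abs_real_inner_le_norm (y - (x + ρ • e)) e
        rw [he, mul_one] at h1
        have h2 := (abs_le.1 (h1.trans hy.le)).1
        have h3 := (abs_lt.1 (h1.trans_lt hy)).1
        rw [inner_sub_left, inner_add_left, inner_smul_left, real_inner_self_eq_norm_sq, he,
          hxe] at h3
        simp only [conj_trivial] at h3
        linarith
    have hxs : planeRefl e μ x = x := by simp [planeRefl, hxe]
    have hH := hopf_lemma (f := w) hwc hN (c := x + ρ • e) (x₀ := x) (v := e) hρ0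
      (fun y hy => by
        obtain ⟨h1, h2⟩ := hsub y hy
        rw [hw, lapl_sub (contDiff_comp_planeRefl hψ e μ) hψ, lapl_comp_planeRefl hψ he]
        have h1' := hl y h1
        have h2' := hl _ (planeRefl_mem_ball he hR hμ.le h1 h2.le)
        have h3 := hF (hP y h1 h2)
        linarith)
      (fun y hy => sub_pos.2 (hlt y (hsub y hy).1 (hsub y hy).2))
      (by
        rw [sub_add_cancel_left, norm_neg, norm_smul, he, mul_one, Real.norm_of_nonneg hρ0.le])
      (by simp [hw, hxs])
      (by
        rw [add_sub_cancel_left, inner_smul_left, real_inner_self_eq_norm_sq, he]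
        simpa using hρ0)
    -- compute the derivative of `w` along `e`
    have hd := hψ.differentiable (by norm_num)
    have h1 := deriv_line (hwc.differentiable (by norm_num)) x e 0
    have h2 := deriv_line hd x e 0
    have h3 := deriv_line hd x (-e) 0
    simp only [zero_smul, add_zero] at h1 h2 h3
    have h4 : (fun s : ℝ => w (x + s • e)) = fun s => ψ (x + s • -e) - ψ (x + s • e) := by
      funext s
      simp only [hw, planeRefl]
      have : ⟪x + s • e, e⟫_ℝ = μ + s := by
        rw [inner_add_left, inner_smul_left, real_inner_self_eq_norm_sq, he, hxe]; simp
      rw [this]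
      congr 2
      rw [add_assoc, ← add_smul, smul_neg, ← neg_smul]
      congr 2
      ring
    rw [h4] at h1
    have h5 := h1.unique (h3.sub h2)
    rw [h5, map_neg] at hH
    linarith
  · have hH := hopf_lemma (f := ψ) hψ hN (c := 0) (x₀ := x) (v := -e) hR
      (fun y hy => by have := hl y hy; have := hF0 (ψ y); linarith) hpos
      (by simpa using hxR) (h0 x hxR) (by simp [hxe, hμ])
    rw [map_neg] at hH
    linarith

theorem le_planeRefl_eventually (hN : N ≠ 0) (hψ : ContDiff ℝ 2 ψ) {F : ℝ → ℝ} (hF : Monotone F)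
    (hF0 : ∀ t, 0 ≤ F t)
    {R : ℝ} (hR : 0 < R) (hl : ∀ x ∈ ball 0 R, -lapl ψ x = F (ψ x))
    (h0 : ∀ x, ‖x‖ = R → ψ x = 0) (hpos : ∀ x ∈ ball 0 R, 0 < ψ x)
    {e : EuclideanSpace ℝ (Fin N)} (he : ‖e‖ = 1) {μ : ℝ} (hμ : 0 < μ)
    (hP : ∀ x ∈ ball 0 R, μ < ⟪x, e⟫_ℝ → ψ x ≤ ψ (planeRefl e μ x)) :
    ∀ᶠ ν in 𝓝[<] μ, ∀ x ∈ ball 0 R, ν < ⟪x, e⟫_ℝ → ψ x ≤ ψ (planeRefl e ν x) := by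
  by_contra hcon
  rw [not_eventually] at hcon
  obtain ⟨ν, hν, hbad⟩ := exists_seq_forall_of_frequently hcon
  push Not at hbad
  choose x hx hxe hlt using hbad
  obtain ⟨z, hz, φ, hφ, hlim⟩ := (isCompact_closedBall (0 : EuclideanSpace ℝ (Fin N)) R).tendsto_subseq
    (fun n => ball_subset_closedBall (hx n))
  have hνlim : Tendsto (ν ∘ φ) atTop (𝓝 μ) :=
    (hν.mono_right nhdsWithin_le_nhds).comp hφ.tendsto_atTop
  have hzR : ‖z‖ ≤ R := by simpa using hz
  have hinlim : Tendsto (fun n => ⟪x (φ n), e⟫_ℝ) atTop (𝓝 ⟪z, e⟫_ℝ) :=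
    ((continuous_id.inner continuous_const).tendsto z).comp hlim
  have hze : μ ≤ ⟪z, e⟫_ℝ := le_of_tendsto_of_tendsto' hνlim hinlim fun n => (hxe (φ n)).le
  have hrefl : Tendsto (fun n => planeRefl e (ν (φ n)) (x (φ n))) atTop (𝓝 (planeRefl e μ z)) :=
    ((continuous_planeRefl_uncurry e).tendsto (μ, z)).comp (hνlim.prodMk_nhds hlim)
  have hle : ψ (planeRefl e μ z) ≤ ψ z :=
    le_of_tendsto_of_tendsto' ((hψ.continuous.tendsto _).comp hrefl)
      ((hψ.continuous.tendsto _).comp hlim) fun n => (hlt (φ n)).le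
  rcases hze.lt_or_eq with hgt | heq
  · have hμR : μ < R := by
      have := real_inner_le_norm z e
      rw [he] at this
      linarith
    rcases hzR.lt_or_eq with h | h
    · have := lt_planeRefl_of_le hN hψ hF hR hl h0 hpos he hμ hμR hP z (by simpa using h) hgt
      linarith
    · rw [h0 z h] at hle
      have := hpos _ (planeRefl_mem_ball_of_norm_eq he hR hμ h hgt)
      linarith
  · have hneg := fderiv_neg_on_plane hN hψ hF hF0 hR hl h0 hpos he hμ hP hzR heq.symm
    -- points where the derivative along `e` is nonnegative
    have hex : ∀ n, ∃ t : ℝ, |t| ≤ 2 * (⟪x n, e⟫_ℝ - ν n) ∧ 0 ≤ fderiv ℝ ψ (x n + t • e) e := by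
      intro n
      have hτ : 2 * (ν n - ⟪x n, e⟫_ℝ) < 0 := by linarith [hxe n]
      have hder := fun t => deriv_line (hψ.differentiable (by norm_num)) (x n) e t
      obtain ⟨c, hc, hcd⟩ := exists_hasDerivAt_eq_slope (fun s : ℝ => ψ (x n + s • e))
        (fun t => fderiv ℝ ψ (x n + t • e) e) hτ
        (fun t _ => (hder t).continuousAt.continuousWithinAt) (fun t _ => hder t)
      refine ⟨c, ?_, ?_⟩
      · rw [abs_of_neg hc.2]
        linarith [hc.1]
      · rw [hcd]
        have := hlt n
        simp only [planeRefl] at this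
        simp only [zero_smul, add_zero, zero_sub]
        refine div_nonneg ?_ ?_ <;> linarith
    choose t ht1 ht2 using hex
    have htlim : Tendsto (fun n => t (φ n)) atTop (𝓝 0) := by
      refine squeeze_zero_norm (fun n => ht1 (φ n)) ?_
      have := (hinlim.sub hνlim).const_mul 2
      rw [← heq, sub_self, mul_zero] at this
      exact this
    have hcont : Continuous fun y => fderiv ℝ ψ y e :=
      ((hψ.fderiv_right (m := 1) (by norm_num)).continuous).clm_apply continuous_const
    have hylim : Tendsto (fun n => x (φ n) + t (φ n) • e) atTop (𝓝 z) := by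
      simpa using hlim.add (htlim.smul_const e)
    have := ge_of_tendsto' ((hcont.tendsto z).comp hylim) fun n => ht2 (φ n)
    linarith

theorem le_planeRefl_zero (hN : N ≠ 0) (hψ : ContDiff ℝ 2 ψ) {F : ℝ → ℝ} (hF : Monotone F)
    (hF0 : ∀ t, 0 ≤ F t)
    {R : ℝ} (hR : 0 < R) (hl : ∀ x ∈ ball 0 R, -lapl ψ x = F (ψ x))
    (h0 : ∀ x, ‖x‖ = R → ψ x = 0) (hpos : ∀ x ∈ ball 0 R, 0 < ψ x)
    {e : EuclideanSpace ℝ (Fin N)} (he : ‖e‖ = 1) :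
    ∀ x ∈ ball 0 R, 0 < ⟪x, e⟫_ℝ → ψ x ≤ ψ (planeRefl e 0 x) := by
  set S : Set ℝ :=
    {r | ∀ x ∈ ball 0 R, R - r < ⟪x, e⟫_ℝ → ψ x ≤ ψ (planeRefl e (R - r) x)} with hS
  have hScl : IsClosed S := by
    have : S = ⋂ x ∈ ball (0 : EuclideanSpace ℝ (Fin N)) R,
        ({r | ⟪x, e⟫_ℝ ≤ R - r} ∪ {r | ψ x ≤ ψ (planeRefl e (R - r) x)}) := by
      ext r
      simp only [hS, Set.mem_ofPred_eq, mem_iInter, mem_union]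
      refine forall₂_congr fun x _ => ?_
      rw [imp_iff_not_or, not_lt]
    rw [this]
    refine isClosed_biInter fun x _ => IsClosed.union ?_ ?_
    · exact isClosed_le continuous_const (by fun_prop)
    · refine isClosed_le continuous_const (hψ.continuous.comp ?_)
      unfold planeRefl
      fun_prop
  have hsub : Icc 0 R ⊆ S := by
    refine IsClosed.Icc_subset_of_forall_mem_nhdsWithin (hScl.inter isClosed_Icc) ?_ ?_
    · intro x hx hxe
      have := real_inner_le_norm x e
      rw [he] at this
      rw [mem_ball_zero_iff] at hx
      linarith
    · rintro r ⟨hr, hr0, hrR⟩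
      have hev := le_planeRefl_eventually hN hψ hF hF0 hR hl h0 hpos he (sub_pos.2 hrR) hr
      have ht : Tendsto (fun s : ℝ => R - s) (𝓝[>] r) (𝓝[<] (R - r)) := by
        refine tendsto_nhdsWithin_iff.2 ⟨?_, ?_⟩
        · have : Continuous fun s : ℝ => R - s := by fun_prop
          exact (this.tendsto r).mono_left nhdsWithin_le_nhds
        · filter_upwards [self_mem_nhdsWithin] with s hs
          have : r < s := hs
          simpa using this
      exact ht.eventually hev
  have := hsub (right_mem_Icc.2 hR.le)
  simpa [hS] using this

/-- **Gidas–Ni–Nirenberg** on a ball, for a nonnegative nondecreasing nonlinearity. -/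
theorem radial_of_pos (hN : N ≠ 0) (hψ : ContDiff ℝ 2 ψ) {F : ℝ → ℝ} (hF : Monotone F)
    (hF0 : ∀ t, 0 ≤ F t)
    {R : ℝ} (hR : 0 < R) (hl : ∀ x ∈ ball 0 R, -lapl ψ x = F (ψ x))
    (h0 : ∀ x, ‖x‖ = R → ψ x = 0) (hpos : ∀ x ∈ ball 0 R, 0 < ψ x) :
    ∀ x ∈ ball 0 R, ∀ y ∈ ball 0 R, ‖x‖ = ‖y‖ → ψ x = ψ y := by
  have key : ∀ x ∈ ball (0 : EuclideanSpace ℝ (Fin N)) R, ∀ y ∈ ball (0 : EuclideanSpace ℝ (Fin N)) R,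
      ‖x‖ = ‖y‖ → ψ x ≤ ψ y := by
    intro x hx y hy hxy
    rcases eq_or_ne x y with rfl | hne
    · rfl
    set d : ℝ := ‖x - y‖ with hd
    have hd0 : 0 < d := norm_pos_iff.2 (sub_ne_zero.2 hne)
    set e : EuclideanSpace ℝ (Fin N) := d⁻¹ • (x - y) with he
    have hen : ‖e‖ = 1 := by
      rw [he, norm_smul, ← hd, Real.norm_of_nonneg (by positivity), inv_mul_cancel₀ hd0.ne']
    have hin : ⟪x, x - y⟫_ℝ = d ^ 2 / 2 := by
      rw [hd, norm_sub_sq_real, inner_sub_right, real_inner_self_eq_norm_sq, ← hxy]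
      ring
    have hxe : ⟪x, e⟫_ℝ = d / 2 := by
      rw [he, inner_smul_right, hin]
      field_simp
    have hre : planeRefl e 0 x = y := by
      rw [planeRefl, hxe, he, smul_smul]
      have : 2 * (0 - d / 2) * d⁻¹ = -1 := by field_simp; ring
      rw [this]
      simp
    have := le_planeRefl_zero hN hψ hF hF0 hR hl h0 hpos hen x hx (by rw [hxe]; positivity)
    rwa [hre] at this
  exact fun x hx y hy h => le_antisymm (key x hx y hy h) (key y hy x hx h.symm)

end MovingPlanes

section RadialUniqueness

variable {N : ℕ} {u : EuclideanSpace ℝ (Fin N) → ℝ}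

theorem fderiv_tangent_eq_zero (hu : Differentiable ℝ u) {R : ℝ}
    (hrad : ∀ x ∈ ball 0 R, ∀ y ∈ ball 0 R, ‖x‖ = ‖y‖ → u x = u y)
    {y v : EuclideanSpace ℝ (Fin N)} (hy : y ∈ ball 0 R) (hyv : ⟪y, v⟫_ℝ = 0) (hn : ‖v‖ = ‖y‖) :
    fderiv ℝ u y v = 0 := by
  have hnorm : ∀ θ : ℝ, ‖Real.cos θ • y + Real.sin θ • v‖ = ‖y‖ := by
    intro θ
    have : ‖Real.cos θ • y + Real.sin θ • v‖ ^ 2 = ‖y‖ ^ 2 := by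
      rw [norm_add_sq_real, inner_smul_left, inner_smul_right, hyv, norm_smul, norm_smul, hn,
        mul_pow, mul_pow, Real.norm_eq_abs, Real.norm_eq_abs, sq_abs, sq_abs]
      have := Real.sin_sq_add_cos_sq θ
      linear_combination ‖y‖ ^ 2 * this
    exact (pow_left_inj₀ (norm_nonneg _) (norm_nonneg _) two_ne_zero).1 this
  have hconst : (fun θ : ℝ => u (Real.cos θ • y + Real.sin θ • v)) = fun _ => u y := by
    funext θ
    refine hrad _ ?_ _ hy (hnorm θ)
    rw [mem_ball_zero_iff, hnorm]
    simpa using hy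
  have hcurve : HasDerivAt (fun θ : ℝ => Real.cos θ • y + Real.sin θ • v) v 0 := by
    have := ((Real.hasDerivAt_cos 0).smul_const y).add ((Real.hasDerivAt_sin 0).smul_const v)
    refine (this.congr_deriv ?_)
    simp
  have h1 : HasDerivAt (fun θ : ℝ => u (Real.cos θ • y + Real.sin θ • v)) (fderiv ℝ u y v) 0 := by
    have h2 : HasFDerivAt u (fderiv ℝ u y) (Real.cos 0 • y + Real.sin 0 • v) := by
      simpa using (hu y).hasFDerivAt
    exact h2.comp_hasDerivAt (0 : ℝ) hcurve
  rw [hconst] at h1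
  exact h1.unique (hasDerivAt_const _ _)

theorem lapl_of_radial (hu : ContDiff ℝ 2 u) {R : ℝ}
    (hrad : ∀ x ∈ ball 0 R, ∀ y ∈ ball 0 R, ‖x‖ = ‖y‖ → u x = u y) (i₀ : Fin N)
    {r : ℝ} (hr : 0 < r) (hrR : r < R) :
    lapl u (r • EuclideanSpace.single i₀ (1 : ℝ))
      = fderiv ℝ (fderiv ℝ u) (r • EuclideanSpace.single i₀ (1 : ℝ))
          (EuclideanSpace.single i₀ 1) (EuclideanSpace.single i₀ 1)
        + (N - 1) / r * fderiv ℝ u (r • EuclideanSpace.single i₀ (1 : ℝ))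
          (EuclideanSpace.single i₀ 1) := by
  have hd := hu.differentiable (by norm_num)
  have key : ∀ i ≠ i₀, fderiv ℝ (fderiv ℝ u) (r • EuclideanSpace.single i₀ (1 : ℝ))
      (EuclideanSpace.single i 1) (EuclideanSpace.single i 1)
      = fderiv ℝ u (r • EuclideanSpace.single i₀ (1 : ℝ)) (EuclideanSpace.single i₀ 1) / r := by
    intro i hi
    set e : EuclideanSpace ℝ (Fin N) := EuclideanSpace.single i₀ 1 with he
    set v : EuclideanSpace ℝ (Fin N) := EuclideanSpace.single i 1 with hv
    have hee : ⟪e, e⟫_ℝ = 1 := by simp [he]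
    have hvv : ⟪v, v⟫_ℝ = 1 := by simp [hv]
    have hev : ⟪e, v⟫_ℝ = 0 := by
      rw [he, hv, EuclideanSpace.inner_single_left]
      simp [hi.symm]
    have hve : ⟪v, e⟫_ℝ = 0 := by rw [real_inner_comm, hev]
    have hzero : (fun t : ℝ => fderiv ℝ u (r • e + t • v) (r • v + t • -e)) =ᶠ[𝓝 0] fun _ => 0 := by
      have hball : ∀ᶠ t in 𝓝 (0 : ℝ), r • e + t • v ∈ ball 0 R := by
        have hc : Continuous fun t : ℝ => r • e + t • v := by fun_prop
        refine (hc.tendsto 0).eventually (isOpen_ball.mem_nhds ?_)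
        rw [mem_ball_zero_iff]
        simpa [norm_smul, he, abs_of_pos hr] using hrR
      filter_upwards [hball] with t ht
      refine fderiv_tangent_eq_zero hd hrad ht ?_ ?_
      · simp only [inner_add_left, inner_add_right, inner_smul_left, inner_smul_right,
          inner_neg_right, hee, hvv, hev, hve, conj_trivial]
        ring
      · refine (pow_left_inj₀ (norm_nonneg _) (norm_nonneg _) two_ne_zero).1 ?_
        rw [← real_inner_self_eq_norm_sq, ← real_inner_self_eq_norm_sq]
        simp only [inner_add_left, inner_add_right, inner_smul_left, inner_smul_right,
          inner_neg_right, inner_neg_left, hee, hvv, hev, hve, conj_trivial]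
        ring
    have hc1 : HasDerivAt (fun t : ℝ => r • e + t • v) v 0 := by
      simpa using ((hasDerivAt_id (0 : ℝ)).smul_const v).const_add (r • e)
    have hc2 : HasDerivAt (fun t : ℝ => r • v + t • -e) (-e) 0 := by
      simpa using ((hasDerivAt_id (0 : ℝ)).smul_const (-e)).const_add (r • v)
    have h1 : HasDerivAt (fun t : ℝ => fderiv ℝ u (r • e + t • v))
        (fderiv ℝ (fderiv ℝ u) (r • e) v) 0 := by
      have h2 : HasFDerivAt (fderiv ℝ u) (fderiv ℝ (fderiv ℝ u) (r • e)) (r • e + (0 : ℝ) • v) := by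
        simpa using hasFDerivAt_fderiv_of_contDiff_two hu (r • e)
      exact h2.comp_hasDerivAt (0 : ℝ) hc1
    have h3 := (h1.clm_apply hc2).congr_of_eventuallyEq hzero.symm
    have h4 := h3.unique (hasDerivAt_const _ _)
    simp only [zero_smul, add_zero, map_smul, map_neg, smul_eq_mul] at h4
    field_simp
    linarith
  rw [lapl_eq_sum hu, ← Finset.add_sum_erase _ _ (Finset.mem_univ i₀),
    Finset.sum_congr rfl fun i hi => key i (Finset.ne_of_mem_erase hi)]
  rw [Finset.sum_const, Finset.card_erase_of_mem (Finset.mem_univ _), Finset.card_univ,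
    Fintype.card_fin, nsmul_eq_mul, Nat.cast_pred (Fin.pos i₀)]
  ring

/-- Two radial solutions of `-Δu = F u` on a ball with the same value at the center coincide. -/
theorem radial_unique {u₁ u₂ : EuclideanSpace ℝ (Fin N) → ℝ} (hN : N ≠ 0)
    (hu₁ : ContDiff ℝ 2 u₁) (hu₂ : ContDiff ℝ 2 u₂) {F : ℝ → ℝ} (hF : LocallyLipschitz F) {R : ℝ}
    (hrad₁ : ∀ x ∈ ball 0 R, ∀ y ∈ ball 0 R, ‖x‖ = ‖y‖ → u₁ x = u₁ y)
    (hrad₂ : ∀ x ∈ ball 0 R, ∀ y ∈ ball 0 R, ‖x‖ = ‖y‖ → u₂ x = u₂ y)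
    (hl₁ : ∀ x ∈ ball 0 R, -lapl u₁ x = F (u₁ x)) (hl₂ : ∀ x ∈ ball 0 R, -lapl u₂ x = F (u₂ x))
    (h0 : u₁ 0 = u₂ 0) : ∀ x ∈ ball 0 R, u₁ x = u₂ x := by
  obtain ⟨L, hL0, hL⟩ : ∃ L : ℝ, 0 ≤ L ∧ ∀ x ∈ ball (0 : EuclideanSpace ℝ (Fin N)) R,
      |F (u₁ x) - F (u₂ x)| ≤ L * |u₁ x - u₂ x| := by
    set K : Set ℝ := u₁ '' closedBall 0 R ∪ u₂ '' closedBall 0 R with hK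
    have hKc : IsCompact K := ((isCompact_closedBall _ _).image hu₁.continuous).union
      ((isCompact_closedBall _ _).image hu₂.continuous)
    obtain ⟨L, hL⟩ := hF.locallyLipschitzOn.exists_lipschitzOnWith_of_compact hKc
    refine ⟨L, L.2, fun x hx => ?_⟩
    exact hL.dist_le_mul _ (Or.inl ⟨x, ball_subset_closedBall hx, rfl⟩) _
      (Or.inr ⟨x, ball_subset_closedBall hx, rfl⟩)
  set D : EuclideanSpace ℝ (Fin N) → ℝ := fun x => u₁ x - u₂ x with hD
  have hDc : ContDiff ℝ 2 D := hu₁.sub hu₂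
  have hrad : ∀ x ∈ ball 0 R, ∀ y ∈ ball 0 R, ‖x‖ = ‖y‖ → D x = D y := fun x hx y hy h => by
    simp only [hD, hrad₁ x hx y hy h, hrad₂ x hx y hy h]
  set i₀ : Fin N := ⟨0, Nat.pos_of_ne_zero hN⟩
  set e : EuclideanSpace ℝ (Fin N) := EuclideanSpace.single i₀ 1 with he
  have hen : ‖e‖ = 1 := by simp [he]
  have hball : ∀ r : ℝ, 0 ≤ r → r < R → r • e ∈ ball 0 R := fun r h1 h2 => by
    rw [mem_ball_zero_iff, norm_smul, hen, mul_one, Real.norm_of_nonneg h1]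
    exact h2
  set g : ℝ → ℝ := fun r => D (r • e) with hg
  set g' : ℝ → ℝ := fun r => fderiv ℝ D (r • e) e with hg'
  set g'' : ℝ → ℝ := fun r => fderiv ℝ (fderiv ℝ D) (r • e) e e with hg''
  have hder : ∀ r, HasDerivAt g (g' r) r := fun r => by
    simpa using deriv_line (hDc.differentiable (by norm_num)) 0 e r
  have hder' : ∀ r, HasDerivAt g' (g'' r) r := fun r => by
    simpa using deriv_deriv_line hDc 0 e r
  have hode : ∀ r, 0 < r → r < R →
      g'' r = -((N - 1) / r * g' r) - (F (u₁ (r • e)) - F (u₂ (r • e))) := by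
    intro r hr hrR
    have h1 := lapl_of_radial hDc hrad i₀ hr hrR
    have h2 : lapl D (r • e) = lapl u₁ (r • e) - lapl u₂ (r • e) := lapl_sub hu₁ hu₂ _
    have h3 := hl₁ _ (hball r hr.le hrR)
    have h4 := hl₂ _ (hball r hr.le hrR)
    simp only [hg', hg'']
    linarith
  set E : ℝ → ℝ := fun r => (g r ^ 2 + g' r ^ 2) * Real.exp (-(1 + L) * r) with hE
  have hEd : ∀ r, HasDerivAt E ((2 * g r * g' r + 2 * g' r * g'' r) * Real.exp (-(1 + L) * r)
      + (g r ^ 2 + g' r ^ 2) * (Real.exp (-(1 + L) * r) * (-(1 + L)))) r := by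
    intro r
    have h1 := (((hder r).pow 2).add ((hder' r).pow 2)).mul
      (((hasDerivAt_id r).const_mul (-(1 + L))).exp)
    refine h1.congr_deriv ?_
    simp
  have hanti : AntitoneOn E (Ico 0 R) := by
    refine antitoneOn_of_deriv_nonpos (convex_Ico 0 R)
      (fun r _ => (hEd r).continuousAt.continuousWithinAt)
      (fun r _ => (hEd r).differentiableAt.differentiableWithinAt) fun r hr => ?_
    rw [interior_Ico] at hr
    obtain ⟨hr0, hrR⟩ := hr
    rw [(hEd r).deriv]
    have h1 := hL _ (hball r hr0.le hrR)
    have h2 : |g' r * (F (u₁ (r • e)) - F (u₂ (r • e)))| ≤ L * (|g r| * |g' r|) := by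
      rw [abs_mul]
      have := mul_le_mul_of_nonneg_left h1 (abs_nonneg (g' r))
      simp only [hg, hD]
      linarith
    have h3 : 0 ≤ (N - 1) / r * g' r ^ 2 := by
      have : (1 : ℝ) ≤ N := by exact_mod_cast Nat.one_le_iff_ne_zero.2 hN
      have : (0 : ℝ) ≤ N - 1 := by linarith
      positivity
    have h4 := (abs_le.1 h2).1
    have h5 : g r * g' r ≤ |g r| * |g' r| := by
      rw [← abs_mul]
      exact le_abs_self _
    have h6 : 2 * (|g r| * |g' r|) ≤ g r ^ 2 + g' r ^ 2 := by
      have := sq_nonneg (|g r| - |g' r|)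
      rw [← sq_abs (g r), ← sq_abs (g' r)]
      linarith
    have h7 := mul_le_mul_of_nonneg_left h6 (by linarith : 0 ≤ 1 + L)
    have h8 : 2 * g r * g' r + 2 * g' r * g'' r - (1 + L) * (g r ^ 2 + g' r ^ 2) ≤ 0 := by
      rw [hode r hr0 hrR]
      linarith
    have := mul_nonpos_of_nonpos_of_nonneg h8 (Real.exp_pos (-(1 + L) * r)).le
    linarith
  intro x hx
  have hxR : ‖x‖ < R := by simpa using hx
  have hR : 0 < R := (norm_nonneg x).trans_lt hxR
  have hg0 : g 0 = 0 := by simp [hg, hD, h0]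
  have hg'0 : g' 0 = 0 := by
    have h1 : HasDerivAt (fun r => g (-r)) (-g' 0) 0 := by
      have h2 : HasDerivAt g (g' 0) (-0) := by simpa using hder 0
      exact (h2.comp (0 : ℝ) (hasDerivAt_neg 0)).congr_deriv (by ring)
    have h2 : (fun r => g (-r)) =ᶠ[𝓝 0] g := by
      filter_upwards [Ioo_mem_nhds (neg_lt_zero.2 hR) hR] with r hr
      have hn : ∀ s : ℝ, ‖s • e‖ = |s| := fun s => by simp [norm_smul, hen]
      refine hrad _ ?_ _ ?_ ?_
      · rw [mem_ball_zero_iff, hn, abs_neg, abs_lt]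
        exact hr
      · rw [mem_ball_zero_iff, hn, abs_lt]
        exact hr
      · rw [hn, hn, abs_neg]
    have := (h1.congr_of_eventuallyEq h2.symm).unique (hder 0)
    linarith
  have hEx : E ‖x‖ ≤ E 0 := hanti ⟨le_rfl, hR⟩ ⟨norm_nonneg x, hxR⟩ (norm_nonneg x)
  have hE0 : E 0 = 0 := by simp [hE, hg0, hg'0]
  rw [hE0] at hEx
  have hgx : g ‖x‖ = 0 := by
    have h1 : g ‖x‖ ^ 2 + g' ‖x‖ ^ 2 ≤ 0 := by
      by_contra! hlt
      have := mul_pos hlt (Real.exp_pos (-(1 + L) * ‖x‖))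
      simp only [hE] at hEx
      linarith
    have := sq_nonneg (g' ‖x‖)
    have := sq_nonneg (g ‖x‖)
    exact pow_eq_zero_iff two_ne_zero |>.1 (by linarith)
  have hDx : D x = D (‖x‖ • e) :=
    hrad x hx _ (hball _ (norm_nonneg x) hxR) (by simp [norm_smul, hen])
  have : D x = 0 := hDx.trans hgx
  exact sub_eq_zero.1 this

end RadialUniqueness

section PositivePartPower

theorem hasDerivAt_max_rpow {p : ℝ} (hp : 1 < p) (t : ℝ) :
    HasDerivAt (fun t : ℝ => (max t 0) ^ p) (p * (max t 0) ^ (p - 1)) t := by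
  have hp0 : p ≠ 0 := by linarith
  have hp1 : p - 1 ≠ 0 := by linarith
  have hc : ∀ q : ℝ, 0 < q → Continuous fun t : ℝ => (max t 0) ^ q := fun q hq =>
    (continuous_id.max continuous_const).rpow_const fun _ => Or.inr hq.le
  refine hasDerivAt_of_hasDerivAt_of_ne' (x := 0) (g := fun t => p * (max t 0) ^ (p - 1))
    (fun y hy => ?_) (hc p (by linarith)).continuousAt
    (continuous_const.mul (hc (p - 1) (by linarith))).continuousAt t
  rcases hy.lt_or_gt with h | h
  · have : (fun t : ℝ => (max t 0) ^ p) =ᶠ[𝓝 y] fun _ => 0 := by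
      filter_upwards [eventually_lt_nhds h] with s hs
      rw [max_eq_right hs.le, Real.zero_rpow hp0]
    rw [max_eq_right h.le, Real.zero_rpow hp1, mul_zero]
    exact (hasDerivAt_const y (0 : ℝ)).congr_of_eventuallyEq this
  · have : (fun t : ℝ => (max t 0) ^ p) =ᶠ[𝓝 y] fun t => t ^ p := by
      filter_upwards [eventually_gt_nhds h] with s hs
      rw [max_eq_left hs.le]
    rw [max_eq_left h.le]
    exact (Real.hasDerivAt_rpow_const (Or.inr hp.le)).congr_of_eventuallyEq this

theorem continuous_max_rpow {p : ℝ} (hp : 0 ≤ p) : Continuous fun t : ℝ => (max t 0) ^ p :=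
  (continuous_id.max continuous_const).rpow_const fun _ => Or.inr hp

theorem monotone_max_rpow {p : ℝ} (hp : 0 ≤ p) : Monotone fun t : ℝ => (max t 0) ^ p :=
  fun _ _ h => Real.rpow_le_rpow (le_max_right _ _) (max_le_max_right 0 h) hp

theorem locallyLipschitz_max_rpow {p : ℝ} (hp : 1 < p) (c : ℝ) :
    LocallyLipschitz fun t : ℝ => c * (max t 0) ^ p := by
  have h : ContDiff ℝ 1 fun t : ℝ => (max t 0) ^ p := by
    rw [contDiff_one_iff_deriv]
    refine ⟨fun t => (hasDerivAt_max_rpow hp t).differentiableAt, ?_⟩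
    rw [funext fun t => (hasDerivAt_max_rpow hp t).deriv]
    exact continuous_const.mul (continuous_max_rpow (by linarith))
  exact (contDiff_const.mul h).locallyLipschitz

theorem max_mul_rpow {θ : ℝ} (hθ : 0 ≤ θ) (t p : ℝ) :
    (max (θ * t) 0) ^ p = θ ^ p * (max t 0) ^ p := by
  rw [← Real.mul_rpow hθ (le_max_right _ _), mul_max_of_nonneg _ _ hθ, mul_zero]

end PositivePartPower

section UnitBall

variable {N : ℕ}

theorem RN_pos (hN : N ≠ 0) : 0 < RN N := by
  have : Nonempty (Fin N) := ⟨⟨0, Nat.pos_of_ne_zero hN⟩⟩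
  exact Real.rpow_pos_of_pos (ENNReal.toReal_pos (measure_ball_pos _ _ one_pos).ne'
    measure_ball_lt_top.ne) _

theorem volume_DN (hN : N ≠ 0) : volume (DN N) = 1 := by
  have : Nonempty (Fin N) := ⟨⟨0, Nat.pos_of_ne_zero hN⟩⟩
  have hV0 : 0 < (volume (ball (0 : EuclideanSpace ℝ (Fin N)) 1)).toReal :=
    ENNReal.toReal_pos (measure_ball_pos _ _ one_pos).ne' measure_ball_lt_top.ne
  rw [DN, Measure.addHaar_ball _ _ (RN_pos hN).le, finrank_euclideanSpace_fin]
  rw [← ENNReal.ofReal_toReal (measure_ball_lt_top (μ := volume)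
    (x := (0 : EuclideanSpace ℝ (Fin N))) (r := 1)).ne, ← ENNReal.ofReal_mul (by
      have := RN_pos hN
      positivity)]
  rw [RN, ← Real.rpow_natCast, ← Real.rpow_mul hV0.le]
  have : -(1 : ℝ) / N * N = -1 := by field_simp
  rw [this, Real.rpow_neg_one, inv_mul_cancel₀ hV0.ne', ENNReal.ofReal_one]

theorem integrableOn_ball {f : EuclideanSpace ℝ (Fin N) → ℝ} (hf : Continuous f) (R : ℝ) :
    IntegrableOn f (ball 0 R) :=
  (hf.continuousOn.integrableOn_compact (isCompact_closedBall 0 R)).mono_set ball_subset_closedBall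

/-- Behaviour of the constraint under the scaling `w ↦ θ w(κ ·)`. -/
theorem integral_scaling_le {w : EuclideanSpace ℝ (Fin N) → ℝ} {p θ κ R : ℝ}
    (hp : 0 < p) (hθ : 0 < θ) (hκ : 1 ≤ κ) (hR : 0 < R) {u : EuclideanSpace ℝ (Fin N) → ℝ}
    (hu : Continuous u) (huw : ∀ x ∈ ball 0 (R / κ), u x = θ * w (κ • x)) :
    θ ^ p * (κ ^ N)⁻¹ * ∫ x in ball 0 R, (max (w x) 0) ^ p ≤ ∫ x in ball 0 R, (max (u x) 0) ^ p := by
  have hκ0 : 0 < κ := by linarith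
  have h1 : ∫ x in ball (0 : EuclideanSpace ℝ (Fin N)) (R / κ), (max (u x) 0) ^ p
      = ∫ x in ball (0 : EuclideanSpace ℝ (Fin N)) (R / κ), θ ^ p * (max (w (κ • x)) 0) ^ p := by
    refine setIntegral_congr_fun measurableSet_ball fun x hx => ?_
    simp only [huw x hx, max_mul_rpow hθ.le]
  have h2 := Measure.setIntegral_comp_smul_of_pos (volume : Measure (EuclideanSpace ℝ (Fin N)))
    (fun x => (max (w x) 0) ^ p) (ball 0 (R / κ)) hκ0
  rw [_root_.smul_ball hκ0.ne', smul_zero, Real.norm_of_nonneg hκ0.le, mul_div_cancel₀ _ hκ0.ne',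
    finrank_euclideanSpace_fin, smul_eq_mul] at h2
  rw [integral_const_mul, h2, ← mul_assoc] at h1
  rw [← h1]
  refine setIntegral_mono_set (integrableOn_ball ((continuous_max_rpow hp.le).comp hu) R) ?_ ?_
  · exact Eventually.of_forall fun x => Real.rpow_nonneg (le_max_right _ _) _
  · exact (ball_subset_ball (div_le_self hR.le hκ)).eventuallyLE

end UnitBall

section Uniqueness

variable {N : ℕ} {p lam α : ℝ} {ψ : EuclideanSpace ℝ (Fin N) → ℝ}

theorem IsSol.eq_zero_of_norm_eq (hN : N ≠ 0) (h : IsSol (DN N) p lam α ψ)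
    {x : EuclideanSpace ℝ (Fin N)} (hx : ‖x‖ = RN N) : ψ x = 0 := by
  refine h.2.2.1 x ?_
  rw [DN, frontier_ball _ (RN_pos hN).ne']
  simpa using hx

theorem IsSol.pos (hN : N ≠ 0) (h : IsSol (DN N) p lam α ψ) : ∀ x ∈ DN N, 0 < ψ x := by
  obtain ⟨hc, hl, hb, hi⟩ := h
  have hle : ∀ x ∈ DN N, lapl ψ x ≤ 0 := fun x hx => by
    have := hl x hx
    have := Real.rpow_nonneg (le_max_right (α + lam * ψ x) 0) p
    linarith
  have hnn := nonneg_of_lapl_nonpos hc hN isOpen_ball isBounded_ball hle fun x hx => (hb x hx).ge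
  by_cases hex : ∃ x ∈ DN N, 0 < ψ x
  · obtain ⟨x, hx, hx0⟩ := hex
    exact pos_of_lapl_nonpos hc hN isOpen_ball (convex_ball _ _).isPreconnected hle
      (fun x hx => hnn x (subset_closure hx)) hx hx0
  · exfalso
    push Not at hex
    have hz : ∀ x ∈ DN N, ψ x = 0 := fun x hx =>
      le_antisymm (hex x hx) (hnn x (subset_closure hx))
    have hzero : ∀ x ∈ DN N, (max (α + lam * ψ x) 0) ^ p = 0 := by
      intro x hx
      rw [← hl x hx, neg_eq_zero]
      have hev : ψ =ᶠ[𝓝 x] fun _ => 0 := by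
        filter_upwards [isOpen_ball.mem_nhds hx] with y hy using hz y hy
      rw [lapl_eq_laplacian hc, (laplacian_congr_nhds hev).eq_of_nhds]
      simp
    have hi' : ∫ x in DN N, (max (α + lam * ψ x) 0) ^ p = ∫ _ in DN N, (0 : ℝ) :=
      setIntegral_congr_fun (s := DN N) measurableSet_ball hzero
    rw [hi', integral_zero] at hi
    exact zero_ne_one hi

theorem IsSol.radial (hN : N ≠ 0) (hp : 1 < p) (hlam : 0 ≤ lam) (h : IsSol (DN N) p lam α ψ) :
    ∀ x ∈ ball 0 (RN N), ∀ y ∈ ball 0 (RN N), ‖x‖ = ‖y‖ → ψ x = ψ y :=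
  radial_of_pos hN h.1 (F := fun t => (max (α + lam * t) 0) ^ p)
    (fun _ _ hst => monotone_max_rpow (by linarith)
      (add_le_add_right (mul_le_mul_of_nonneg_left hst hlam) α))
    (fun _ => Real.rpow_nonneg (le_max_right _ _) _) (RN_pos hN) h.2.1
    (fun _ hx => h.eq_zero_of_norm_eq hN hx) (h.pos hN)

theorem IsSol.contDiff_affine (h : IsSol (DN N) p lam α ψ) :
    ContDiff ℝ 2 fun x => α + lam * ψ x :=
  contDiff_const.add (contDiff_const.mul h.1)

theorem lapl_affine (hψ : ContDiff ℝ 2 ψ) (α lam : ℝ) (x : EuclideanSpace ℝ (Fin N)) :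
    lapl (fun x => α + lam * ψ x) x = lam * lapl ψ x := by
  rw [lapl_add contDiff_const (contDiff_const.mul hψ), lapl_const, lapl_const_mul _ hψ, zero_add]

theorem IsSol.lapl_eq (h : IsSol (DN N) p lam α ψ) : ∀ x ∈ ball 0 (RN N),
    -lapl (fun x => α + lam * ψ x) x = lam * (max (α + lam * ψ x) 0) ^ p := by
  intro x hx
  rw [lapl_affine h.1, ← h.2.1 x hx]
  ring

theorem IsSol.center_pos (hN : N ≠ 0) (hp : 1 < p) (hlam : 0 ≤ lam)
    (h : IsSol (DN N) p lam α ψ) : 0 < α + lam * ψ 0 := by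
  by_contra! hle
  have hconst := radial_unique hN h.contDiff_affine
    (contDiff_const (c := α + lam * ψ 0)) (locallyLipschitz_max_rpow hp lam)
    (fun x hx y hy hxy => by rw [h.radial hN hp hlam x hx y hy hxy]) (fun _ _ _ _ _ => rfl)
    h.lapl_eq (fun x _ => by
      rw [lapl_const, max_eq_right hle, Real.zero_rpow (by linarith)]
      simp) rfl
  have hi := h.2.2.2
  have hi' : ∫ x in DN N, (max (α + lam * ψ x) 0) ^ p = ∫ _ in DN N, (0 : ℝ) :=
    setIntegral_congr_fun (s := DN N) measurableSet_ball fun x hx => by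
      simp only [hconst x hx, max_eq_right hle, Real.zero_rpow (by linarith : p ≠ 0)]
  rw [hi', integral_zero] at hi
  exact zero_ne_one hi

theorem rpow_half_sq {θ : ℝ} (hθ : 0 < θ) (p : ℝ) : (θ ^ ((p - 1) / 2)) ^ 2 = θ ^ (p - 1) := by
  rw [← Real.rpow_natCast, ← Real.rpow_mul hθ.le]
  congr 1
  push_cast
  ring

theorem rpow_mul_inv_rpow_half_pow {θ : ℝ} (hθ : 0 < θ) (p : ℝ) (N : ℕ) :
    θ ^ p * ((θ ^ ((p - 1) / 2)) ^ N)⁻¹ = θ ^ (p - N * (p - 1) / 2) := by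
  rw [← Real.rpow_natCast, ← Real.rpow_mul hθ.le, ← Real.rpow_neg hθ.le, ← Real.rpow_add hθ]
  congr 1
  ring

theorem lapl_scaling {w : EuclideanSpace ℝ (Fin N) → ℝ} (hw : ContDiff ℝ 2 w) {θ : ℝ}
    (hθ : 0 < θ) {x : EuclideanSpace ℝ (Fin N)}
    (hx : -lapl w (θ ^ ((p - 1) / 2) • x) = lam * (max (w (θ ^ ((p - 1) / 2) • x)) 0) ^ p) :
    -lapl (fun x => θ * w (θ ^ ((p - 1) / 2) • x)) x
      = lam * (max (θ * w (θ ^ ((p - 1) / 2) • x)) 0) ^ p := by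
  have hc : ContDiff ℝ 2 fun x => w (θ ^ ((p - 1) / 2) • x) := by fun_prop
  rw [lapl_const_mul _ hc, lapl_comp_smul hw, max_mul_rpow hθ.le, rpow_half_sq hθ]
  have : θ ^ p = θ * θ ^ (p - 1) := by
    have h := Real.rpow_add hθ 1 (p - 1)
    rwa [Real.rpow_one, add_sub_cancel] at h
  rw [this]
  linear_combination θ * θ ^ (p - 1) * hx

theorem IsSol.center_le (hN : N ≠ 0) (hp : 1 < p) (hpN : N * (p - 1) / 2 < p) (hlam : 0 ≤ lam)
    {α₁ α₂ : ℝ} {ψ₁ ψ₂ : EuclideanSpace ℝ (Fin N) → ℝ}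
    (h₁ : IsSol (DN N) p lam α₁ ψ₁) (h₂ : IsSol (DN N) p lam α₂ ψ₂) :
    α₁ + lam * ψ₁ 0 ≤ α₂ + lam * ψ₂ 0 := by
  by_contra! hlt
  have hpos := h₂.center_pos hN hp hlam
  set u₁ : EuclideanSpace ℝ (Fin N) → ℝ := fun x => α₁ + lam * ψ₁ x with hu₁
  set u₂ : EuclideanSpace ℝ (Fin N) → ℝ := fun x => α₂ + lam * ψ₂ x with hu₂
  have hR := RN_pos hN
  set θ : ℝ := u₁ 0 / u₂ 0 with hθ
  have hθ1 : 1 < θ := (one_lt_div hpos).2 hlt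
  have hθ0 : 0 < θ := by linarith
  set κ : ℝ := θ ^ ((p - 1) / 2) with hκ
  have hκ1 : 1 ≤ κ := Real.one_le_rpow hθ1.le (by linarith)
  have hκ0 : 0 < κ := by linarith
  have hu₂c : ContDiff ℝ 2 u₂ := h₂.contDiff_affine
  have hsub : ball (0 : EuclideanSpace ℝ (Fin N)) (RN N / κ) ⊆ ball 0 (RN N) :=
    ball_subset_ball (div_le_self hR.le hκ1)
  have hmem : ∀ x ∈ ball (0 : EuclideanSpace ℝ (Fin N)) (RN N / κ), κ • x ∈ ball 0 (RN N) := by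
    intro x hx
    rw [mem_ball_zero_iff] at hx ⊢
    rw [norm_smul, Real.norm_of_nonneg hκ0.le]
    rwa [lt_div_iff₀' hκ0] at hx
  have heq := radial_unique hN h₁.contDiff_affine (u₂ := fun x => θ * u₂ (κ • x))
    (by fun_prop) (locallyLipschitz_max_rpow hp lam) (R := RN N / κ)
    (fun x hx y hy hxy => by rw [h₁.radial hN hp hlam x (hsub hx) y (hsub hy) hxy])
    (fun x hx y hy hxy => by
      simp only [hu₂]
      rw [h₂.radial hN hp hlam _ (hmem x hx) _ (hmem y hy) (by rw [norm_smul, norm_smul, hxy])])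
    (fun x hx => h₁.lapl_eq x (hsub hx))
    (fun x hx => lapl_scaling hu₂c hθ0 (h₂.lapl_eq _ (hmem x hx)))
    (by
      simp only [smul_zero]
      rw [hθ, div_mul_cancel₀ _ hpos.ne'])
  have hint := integral_scaling_le (w := u₂) (p := p) (by linarith) hθ0 hκ1 hR
    h₁.contDiff_affine.continuous heq
  have e1 : ∫ x in ball 0 (RN N), (max (u₂ x) 0) ^ p = 1 := h₂.2.2.2
  have e2 : ∫ x in ball 0 (RN N), (max (u₁ x) 0) ^ p = 1 := h₁.2.2.2
  rw [e1, e2, hκ, rpow_mul_inv_rpow_half_pow hθ0, mul_one] at hint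
  exact (Real.one_lt_rpow hθ1 (by linarith)).not_ge hint

theorem IsSol.unique (hN : N ≠ 0) (hp : 1 < p) (hpN : N * (p - 1) / 2 < p) (hlam : 0 ≤ lam)
    {α₁ α₂ : ℝ} {ψ₁ ψ₂ : EuclideanSpace ℝ (Fin N) → ℝ}
    (h₁ : IsSol (DN N) p lam α₁ ψ₁) (h₂ : IsSol (DN N) p lam α₂ ψ₂) :
    α₁ = α₂ ∧ ∀ x ∈ closure (DN N), ψ₁ x = ψ₂ x := by
  have h0 := le_antisymm (h₁.center_le hN hp hpN hlam h₂) (h₂.center_le hN hp hpN hlam h₁)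
  have heq := radial_unique hN h₁.contDiff_affine h₂.contDiff_affine
    (locallyLipschitz_max_rpow hp lam)
    (fun x hx y hy hxy => by rw [h₁.radial hN hp hlam x hx y hy hxy])
    (fun x hx y hy hxy => by rw [h₂.radial hN hp hlam x hx y hy hxy])
    h₁.lapl_eq h₂.lapl_eq h0
  have hα : α₁ = α₂ := by
    have : Nonempty (Fin N) := ⟨⟨0, Nat.pos_of_ne_zero hN⟩⟩
    obtain ⟨x, hx⟩ := NormedSpace.sphere_nonempty (E := EuclideanSpace ℝ (Fin N)) (x := 0)
      (r := RN N) |>.2 (RN_pos hN).le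
    have hxn : ‖x‖ = RN N := by simpa using hx
    have hcl : x ∈ closure (ball (0 : EuclideanSpace ℝ (Fin N)) (RN N)) := by
      rw [closure_ball _ (RN_pos hN).ne']
      exact sphere_subset_closedBall hx
    have := (Set.EqOn.closure heq h₁.contDiff_affine.continuous h₂.contDiff_affine.continuous) hcl
    simpa [h₁.eq_zero_of_norm_eq hN hxn, h₂.eq_zero_of_norm_eq hN hxn] using this
  refine ⟨hα, ?_⟩
  -- both functions solve the same linear Poisson problem
  have hl : ∀ x ∈ DN N, lapl (fun x => ψ₁ x - ψ₂ x) x = 0 := by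
    intro x hx
    have e1 := h₁.2.1 x hx
    have e2 := h₂.2.1 x hx
    have e3 : α₁ + lam * ψ₁ x = α₂ + lam * ψ₂ x := heq x hx
    rw [e3] at e1
    rw [lapl_sub h₁.1 h₂.1]
    linarith
  intro x hx
  have b1 := nonneg_of_lapl_nonpos (h₁.1.sub h₂.1) hN isOpen_ball isBounded_ball
    (fun x hx => (hl x hx).le)
    (fun x hx => by rw [h₁.2.2.1 x hx, h₂.2.2.1 x hx, sub_self]) x hx
  have b2 := nonneg_of_lapl_nonpos (h₂.1.sub h₁.1) hN isOpen_ball isBounded_ball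
    (fun x hx => by
      have := hl x hx
      rw [lapl_sub h₁.1 h₂.1] at this
      rw [lapl_sub h₂.1 h₁.1]
      linarith)
    (fun x hx => by rw [h₁.2.2.1 x hx, h₂.2.2.1 x hx, sub_self]) x hx
  linarith

end Uniqueness

section RadialProfile

open scoped BoundedContinuousFunction

/-- For the profile `h` of a radial function `x ↦ h (‖x‖ ^ 2)` on `ℝ ^ (n + 1)` with
`-Δ = F`, this is the slope `h'` computed from `h`. -/
def radialSlope (n : ℕ) (F h : ℝ → ℝ) (t : ℝ) : ℝ :=
  -(1 / 2) * ∫ σ in (0 : ℝ)..1, σ ^ n * F (h (t * σ ^ 2))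

theorem continuous_radialSlope (n : ℕ) {F h : ℝ → ℝ} (hF : Continuous F) (hh : Continuous h) :
    Continuous (radialSlope n F h) := by
  refine continuous_const.mul
    (intervalIntegral.continuous_parametric_intervalIntegral_of_continuous' ?_ 0 1)
  simp only [Function.uncurry_def]
  fun_prop

theorem norm_integral_le_of_exp_bound {g : ℝ → ℝ} {C K : ℝ} (hC : 0 ≤ C) (hK : 0 < K)
    (hg : ∀ t, |g t| ≤ C * Real.exp (K * |t|)) (s : ℝ) :
    |∫ t in (0 : ℝ)..s, g t| ≤ C / K * Real.exp (K * |s|) := by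
  have key : ∀ s : ℝ, 0 ≤ s → ∀ g : ℝ → ℝ, (∀ t, |g t| ≤ C * Real.exp (K * |t|)) →
      |∫ t in (0 : ℝ)..s, g t| ≤ C / K * Real.exp (K * |s|) := by
    intro s hs g hg
    have hd : ∀ t : ℝ, HasDerivAt (fun t => C / K * Real.exp (K * t)) (C * Real.exp (K * t)) t := by
      intro t
      have := (((hasDerivAt_id t).const_mul K).exp).const_mul (C / K)
      refine this.congr_deriv ?_
      simp only [id]
      field_simp
    have h1 := intervalIntegral.norm_integral_le_of_norm_le (μ := volume) (f := g)
      (g := fun t => C * Real.exp (K * t)) hs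
      (Eventually.of_forall fun t ht => by
        have := hg t
        rwa [abs_of_pos ht.1] at this)
      (by apply Continuous.intervalIntegrable; fun_prop)
    rw [intervalIntegral.integral_eq_sub_of_hasDerivAt (fun t _ => hd t)
      (by apply Continuous.intervalIntegrable; fun_prop), Real.norm_eq_abs] at h1
    rw [abs_of_nonneg hs]
    have : 0 ≤ C / K * Real.exp (K * 0) := by positivity
    linarith
  rcases le_total 0 s with hs | hs
  · exact key s hs g hg
  · have h := key (-s) (by linarith) (fun t => g (-t)) fun t => by simpa using hg (-t)
    rw [intervalIntegral.integral_comp_neg, neg_neg, neg_zero, intervalIntegral.integral_symm,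
      abs_neg, abs_neg] at h
    exact h

theorem radialSlope_sub_le (n : ℕ) {F : ℝ → ℝ} {L K C : ℝ} (hF : Continuous F) (hL : 0 ≤ L)
    (hK : 0 ≤ K) (hC : 0 ≤ C) (hlip : ∀ a b, |F a - F b| ≤ L * |a - b|) {h₁ h₂ : ℝ → ℝ}
    (hh₁ : Continuous h₁) (hh₂ : Continuous h₂)
    (hb : ∀ t, |h₁ t - h₂ t| ≤ C * Real.exp (K * |t|)) (t : ℝ) :
    |radialSlope n F h₁ t - radialSlope n F h₂ t| ≤ L * C * Real.exp (K * |t|) := by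
  have e : radialSlope n F h₁ t - radialSlope n F h₂ t
      = -(1 / 2) * ∫ σ in (0 : ℝ)..1, σ ^ n * (F (h₁ (t * σ ^ 2)) - F (h₂ (t * σ ^ 2))) := by
    rw [radialSlope, radialSlope, ← mul_sub, ← intervalIntegral.integral_sub]
    · simp only [mul_sub]
    · apply Continuous.intervalIntegrable; fun_prop
    · apply Continuous.intervalIntegrable; fun_prop
  have hle : ‖∫ σ in (0 : ℝ)..1, σ ^ n * (F (h₁ (t * σ ^ 2)) - F (h₂ (t * σ ^ 2)))‖
      ≤ L * C * Real.exp (K * |t|) * |1 - 0| := by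
    refine intervalIntegral.norm_integral_le_of_norm_le_const fun σ hσ => ?_
    rw [uIoc_of_le zero_le_one] at hσ
    rw [norm_mul, norm_pow, Real.norm_eq_abs, Real.norm_eq_abs, abs_of_pos hσ.1]
    have h1 : σ ^ n ≤ 1 := pow_le_one₀ hσ.1.le hσ.2
    have h2 : |t * σ ^ 2| ≤ |t| := by
      rw [abs_mul, abs_of_nonneg (sq_nonneg σ)]
      exact mul_le_of_le_one_right (abs_nonneg t) (pow_le_one₀ hσ.1.le hσ.2)
    have h3 : Real.exp (K * |t * σ ^ 2|) ≤ Real.exp (K * |t|) :=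
      Real.exp_le_exp.2 (mul_le_mul_of_nonneg_left h2 hK)
    calc σ ^ n * |F (h₁ (t * σ ^ 2)) - F (h₂ (t * σ ^ 2))|
        ≤ 1 * (L * (C * Real.exp (K * |t|))) := by
          refine mul_le_mul h1 ((hlip _ _).trans ?_) (abs_nonneg _) zero_le_one
          exact mul_le_mul_of_nonneg_left
            ((hb _).trans (mul_le_mul_of_nonneg_left h3 hC)) hL
      _ = _ := by ring
  rw [e, abs_mul]
  have : |-(1 / 2 : ℝ)| = 1 / 2 := by norm_num
  rw [this]
  have := abs_nonneg (∫ σ in (0 : ℝ)..1, σ ^ n * (F (h₁ (t * σ ^ 2)) - F (h₂ (t * σ ^ 2))))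
  rw [Real.norm_eq_abs, sub_zero, abs_one, mul_one] at hle
  linarith

theorem exists_radial_profile_integral (n : ℕ) {F : ℝ → ℝ} {L : ℝ} (hL : 0 ≤ L)
    (hlip : ∀ a b, |F a - F b| ≤ L * |a - b|) (h0 : F 0 = 0) (c : ℝ) :
    ∃ h : ℝ → ℝ, Continuous h ∧ ∀ s, h s = c + ∫ t in (0 : ℝ)..s, radialSlope n F h t := by
  have hF : Continuous F := by
    have : LipschitzWith L.toNNReal F := LipschitzWith.of_dist_le_mul fun a b => by
      rw [Real.coe_toNNReal _ hL]
      exact hlip a b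
    exact this.continuous
  set K : ℝ := 2 * L + 1 with hK
  have hK0 : 0 < K := by linarith
  have hLK : L / K ≤ 1 / 2 := by
    rw [div_le_div_iff₀ hK0 two_pos]
    linarith
  let H : (ℝ →ᵇ ℝ) → ℝ → ℝ := fun v t => Real.exp (K * |t|) * v t
  have hHc : ∀ v, Continuous (H v) := fun v => by
    have := v.continuous
    fun_prop
  have hHsub : ∀ v w t, |H v t - H w t| ≤ dist v w * Real.exp (K * |t|) := by
    intro v w t
    simp only [H]
    rw [← mul_sub, abs_mul, abs_of_pos (Real.exp_pos _), mul_comm]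
    exact mul_le_mul_of_nonneg_right (v.dist_coe_le_dist t) (Real.exp_pos _).le
  have hcont : ∀ v, Continuous (radialSlope n F (H v)) :=
    fun v => continuous_radialSlope n hF (hHc v)
  let T : (ℝ →ᵇ ℝ) → ℝ → ℝ := fun v s =>
    Real.exp (-(K * |s|)) * (c + ∫ t in (0 : ℝ)..s, radialSlope n F (H v) t)
  have hTc : ∀ v, Continuous (T v) := fun v => by
    have h1 : Continuous fun s => ∫ t in (0 : ℝ)..s, radialSlope n F (H v) t :=
      intervalIntegral.continuous_primitive (fun a b => (hcont v).intervalIntegrable a b) 0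
    fun_prop
  have hTsub : ∀ v w s, |T v s - T w s| ≤ 1 / 2 * dist v w := by
    intro v w s
    have h1 := norm_integral_le_of_exp_bound (by positivity) hK0
      (radialSlope_sub_le n hF hL hK0.le dist_nonneg hlip (hHc v) (hHc w) (hHsub v w)) s
    rw [intervalIntegral.integral_sub ((hcont v).intervalIntegrable _ _)
      ((hcont w).intervalIntegrable _ _)] at h1
    simp only [T]
    rw [← mul_sub, add_sub_add_left_eq_sub, abs_mul, abs_of_pos (Real.exp_pos _)]
    calc _ ≤ Real.exp (-(K * |s|)) * (L * dist v w / K * Real.exp (K * |s|)) :=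
          mul_le_mul_of_nonneg_left h1 (Real.exp_pos _).le
      _ = L / K * dist v w * (Real.exp (-(K * |s|)) * Real.exp (K * |s|)) := by ring
      _ = L / K * dist v w := by rw [← Real.exp_add, neg_add_cancel, Real.exp_zero, mul_one]
      _ ≤ 1 / 2 * dist v w := mul_le_mul_of_nonneg_right hLK dist_nonneg
  have hT0 : ∀ s, |T 0 s| ≤ |c| := by
    intro s
    have : T 0 s = Real.exp (-(K * |s|)) * c := by
      simp [T, H, radialSlope, h0]
    rw [this, abs_mul, abs_of_pos (Real.exp_pos _)]
    refine mul_le_of_le_one_left (abs_nonneg c) (Real.exp_le_one_iff.2 ?_)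
    have := mul_nonneg hK0.le (abs_nonneg s)
    linarith
  have hTb : ∀ v s, ‖T v s‖ ≤ |c| + 1 / 2 * dist v 0 := by
    intro v s
    have h1 := hTsub v 0 s
    have h2 := hT0 s
    have h3 := abs_add_le (T 0 s) (T v s - T 0 s)
    rw [add_sub_cancel] at h3
    rw [Real.norm_eq_abs]
    linarith
  let Φ : (ℝ →ᵇ ℝ) → (ℝ →ᵇ ℝ) := fun v =>
    BoundedContinuousFunction.ofNormedAddCommGroup (T v) (hTc v) _ (hTb v)
  have hΦ : ContractingWith (1 / 2) Φ := by
    refine ⟨by rw [← NNReal.coe_lt_coe]; norm_num, LipschitzWith.of_dist_le_mul fun v w => ?_⟩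
    rw [BoundedContinuousFunction.dist_le (by positivity)]
    intro s
    have := hTsub v w s
    simpa [Φ, Real.dist_eq] using this
  refine ⟨H (ContractingWith.fixedPoint Φ hΦ), hHc _, fun s => ?_⟩
  have hfix := congrArg (fun v : ℝ →ᵇ ℝ => v s) hΦ.fixedPoint_isFixedPt.eq
  have hfix' : T (ContractingWith.fixedPoint Φ hΦ) s = ContractingWith.fixedPoint Φ hΦ s := hfix
  simp only [H]
  rw [← hfix']
  simp only [T]
  rw [← mul_assoc, ← Real.exp_add, add_neg_cancel, Real.exp_zero, one_mul]

theorem hasDerivAt_radialSlope (n : ℕ) {F F' h h' : ℝ → ℝ} (hF : ∀ t, HasDerivAt F (F' t) t)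
    (hF' : Continuous F') (hh : ∀ t, HasDerivAt h (h' t) t) (hh' : Continuous h') (s : ℝ) :
    HasDerivAt (radialSlope n F h)
      (-(1 / 2) * ∫ σ in (0 : ℝ)..1, σ ^ n * (F' (h (s * σ ^ 2)) * (h' (s * σ ^ 2) * σ ^ 2))) s := by
  have hFc : Continuous F := continuous_iff_continuousAt.2 fun t => (hF t).continuousAt
  have hhc : Continuous h := continuous_iff_continuousAt.2 fun t => (hh t).continuousAt
  have hG : Continuous fun q : ℝ × ℝ =>
      q.2 ^ n * (F' (h (q.1 * q.2 ^ 2)) * (h' (q.1 * q.2 ^ 2) * q.2 ^ 2)) := by fun_prop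
  obtain ⟨C, hC⟩ := ((isCompact_closedBall s 1).prod isCompact_Icc).exists_bound_of_continuousOn
    (s := closedBall s 1 ×ˢ Icc (0 : ℝ) 1) hG.continuousOn
  refine HasDerivAt.const_mul _ (intervalIntegral.hasDerivAt_integral_of_dominated_loc_of_deriv_le
    (F := fun t σ => σ ^ n * F (h (t * σ ^ 2)))
    (F' := fun t σ => σ ^ n * (F' (h (t * σ ^ 2)) * (h' (t * σ ^ 2) * σ ^ 2)))
    (bound := fun _ => C) (closedBall_mem_nhds s one_pos) ?_ ?_ ?_ ?_ ?_ ?_).2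
  · refine Eventually.of_forall fun t => Continuous.aestronglyMeasurable ?_
    fun_prop
  · apply Continuous.intervalIntegrable
    fun_prop
  · refine Continuous.aestronglyMeasurable ?_
    fun_prop
  · refine Eventually.of_forall fun σ hσ t ht => ?_
    rw [uIoc_of_le zero_le_one] at hσ
    exact hC (t, σ) ⟨ht, hσ.1.le, hσ.2⟩
  · exact intervalIntegrable_const
  · refine Eventually.of_forall fun σ _ t _ => HasDerivAt.const_mul _ ?_
    have h1 : HasDerivAt (fun t => t * σ ^ 2) (σ ^ 2) t := by
      simpa using (hasDerivAt_id t).mul_const (σ ^ 2)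
    exact (hF _).comp t ((hh _).comp t h1)

/-- Existence of radial solutions of `-Δu = F(u)` with prescribed value at the origin, expressed
through the profile of `u` as a function of `‖x‖ ^ 2`. -/
theorem exists_radial_profile (n : ℕ) {F F' : ℝ → ℝ} {L : ℝ} (hL : 0 ≤ L)
    (hF : ∀ t, HasDerivAt F (F' t) t) (hF' : Continuous F')
    (hlip : ∀ a b, |F a - F b| ≤ L * |a - b|) (h0 : F 0 = 0) (hnn : ∀ t, 0 ≤ F t) (c : ℝ) :
    ∃ h : ℝ → ℝ, ContDiff ℝ 2 h ∧ h 0 = c ∧ (∀ s, 0 ≤ s → h s ≤ c) ∧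
      ∀ s, 4 * s * deriv (deriv h) s + 2 * ((n + 1 : ℕ) : ℝ) * deriv h s = -F (h s) := by
  have hFc : Continuous F := continuous_iff_continuousAt.2 fun t => (hF t).continuousAt
  obtain ⟨h, hhc, hh⟩ := exists_radial_profile_integral n hL hlip h0 c
  have hk := continuous_radialSlope n hFc hhc
  have hd : ∀ s, HasDerivAt h (radialSlope n F h s) s := by
    intro s
    have h1 := (intervalIntegral.integral_hasDerivAt_right (hk.intervalIntegrable 0 s)
      (hk.stronglyMeasurableAtFilter _ _) hk.continuousAt).const_add c
    rwa [← funext hh] at h1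
  have hd2 := hasDerivAt_radialSlope n hF hF' hd hk
  have e1 : deriv h = radialSlope n F h := funext fun s => (hd s).deriv
  have hne : ∀ t, radialSlope n F h t ≤ 0 := by
    intro t
    have : 0 ≤ ∫ σ in (0 : ℝ)..1, σ ^ n * F (h (t * σ ^ 2)) :=
      intervalIntegral.integral_nonneg zero_le_one fun σ hσ =>
        mul_nonneg (pow_nonneg hσ.1 n) (hnn _)
    rw [radialSlope]
    linarith
  have hc0 : h 0 = c := by rw [hh 0, intervalIntegral.integral_same, add_zero]
  refine ⟨h, ?_, hc0, ?_, ?_⟩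
  · rw [show (2 : WithTop ℕ∞) = 1 + 1 by norm_num, contDiff_succ_iff_deriv]
    refine ⟨fun s => (hd s).differentiableAt, by simp, ?_⟩
    rw [e1, contDiff_one_iff_deriv]
    refine ⟨fun s => (hd2 s).differentiableAt, ?_⟩
    rw [funext fun s => (hd2 s).deriv]
    refine continuous_const.mul
      (intervalIntegral.continuous_parametric_intervalIntegral_of_continuous' ?_ 0 1)
    simp only [Function.uncurry_def]
    fun_prop
  · intro s hs
    rw [← hc0]
    exact antitone_of_deriv_nonpos (fun s => (hd s).differentiableAt)
      (fun s => by rw [e1]; exact hne s) hs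
  · intro s
    rw [e1, (hd2 s).deriv, radialSlope]
    have hder : ∀ σ : ℝ, HasDerivAt (fun σ => σ ^ (n + 1) * F (h (s * σ ^ 2)))
        (((n + 1 : ℕ) : ℝ) * (σ ^ n * F (h (s * σ ^ 2)))
          + 2 * s * (σ ^ n * (F' (h (s * σ ^ 2)) * (radialSlope n F h (s * σ ^ 2) * σ ^ 2)))) σ := by
      intro σ
      have h1 : HasDerivAt (fun σ => s * σ ^ 2) (s * (2 * σ)) σ := by
        simpa using ((hasDerivAt_id σ).pow 2).const_mul s
      have h2 := (hasDerivAt_pow (n + 1) σ).mul ((hF _).comp σ ((hd _).comp σ h1))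
      refine h2.congr_deriv ?_
      simp only [Function.comp, add_tsub_cancel_right]
      ring
    have hi1 : IntervalIntegrable (fun σ => σ ^ n * F (h (s * σ ^ 2))) volume 0 1 := by
      apply Continuous.intervalIntegrable
      fun_prop
    have hi2 : IntervalIntegrable (fun σ => σ ^ n * (F' (h (s * σ ^ 2)) *
        (radialSlope n F h (s * σ ^ 2) * σ ^ 2))) volume 0 1 := by
      apply Continuous.intervalIntegrable
      fun_prop
    have hint := intervalIntegral.integral_eq_sub_of_hasDerivAt (a := 0) (b := 1)
      (fun σ _ => hder σ) ((hi1.const_mul _).add (hi2.const_mul _))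
    rw [intervalIntegral.integral_add (hi1.const_mul _) (hi2.const_mul _),
      intervalIntegral.integral_const_mul, intervalIntegral.integral_const_mul] at hint
    simp only [one_pow, one_mul, mul_one, ne_eq, Nat.add_eq_zero_iff, one_ne_zero, and_false,
      not_false_eq_true, zero_pow, zero_mul, sub_zero] at hint
    linear_combination -hint

end RadialProfile

section Existence

variable {N : ℕ} {p : ℝ}

/-- A `C¹` globally Lipschitz nonlinearity that agrees with `(max t 0) ^ p` for `t ≤ 1`. -/
theorem exists_truncation (hp : 1 < p) : ∃ F F' : ℝ → ℝ, (∀ t, HasDerivAt F (F' t) t) ∧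
    Continuous F' ∧ (∀ a b, |F a - F b| ≤ p * |a - b|) ∧ (∀ t, 0 ≤ F t) ∧
    ∀ t ≤ 1, F t = (max t 0) ^ p := by
  have hp1 : 0 < p - 1 := by linarith
  have hp0 : 0 < p := by linarith
  set g : ℝ → ℝ := fun s => p * (max (min s 1) 0) ^ (p - 1) with hg
  have hgc : Continuous g :=
    continuous_const.mul ((continuous_max_rpow hp1.le).comp (continuous_id.min continuous_const))
  have hg0 : ∀ s, 0 ≤ g s := fun s =>
    mul_nonneg hp0.le (Real.rpow_nonneg (le_max_right _ _) _)
  have hgp : ∀ s, g s ≤ p := fun s =>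
    mul_le_of_le_one_right hp0.le (Real.rpow_le_one (le_max_right _ _)
      (max_le (min_le_right _ _) zero_le_one) hp1.le)
  have hd : ∀ t, HasDerivAt (fun t => ∫ s in (0 : ℝ)..t, g s) (g t) t := fun t =>
    intervalIntegral.integral_hasDerivAt_right (hgc.intervalIntegrable 0 t)
      (hgc.stronglyMeasurableAtFilter _ _) hgc.continuousAt
  have heq : ∀ t ≤ (1 : ℝ), ∫ s in (0 : ℝ)..t, g s = (max t 0) ^ p := by
    intro t ht
    have h1 := intervalIntegral.integral_eq_sub_of_hasDerivAt (a := 0) (b := t)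
      (fun s _ => hasDerivAt_max_rpow hp s)
      ((continuous_const.mul (continuous_max_rpow hp1.le)).intervalIntegrable _ _)
    rw [max_self, Real.zero_rpow hp0.ne', sub_zero] at h1
    rw [← h1]
    refine intervalIntegral.integral_congr fun s hs => ?_
    have : s ≤ 1 := hs.2.trans (max_le zero_le_one ht)
    simp only [hg, min_eq_left this]
  have hmono : Monotone fun t => ∫ s in (0 : ℝ)..t, g s :=
    monotone_of_deriv_nonneg (fun t => (hd t).differentiableAt) fun t => by
      rw [(hd t).deriv]
      exact hg0 t
  refine ⟨fun t => ∫ s in (0 : ℝ)..t, g s, g, hd, hgc, ?_, ?_, heq⟩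
  · intro a b
    have := intervalIntegral.norm_integral_le_of_norm_le_const (E := ℝ) (a := b) (b := a) (f := g)
      (C := p) fun s _ => by
        rw [Real.norm_of_nonneg (hg0 s)]
        exact hgp s
    rwa [intervalIntegral.integral_interval_sub_left (hgc.intervalIntegrable _ _)
      (hgc.intervalIntegrable _ _)]
  · intro t
    rcases le_total t 1 with h | h
    · simp only [heq t h]
      exact Real.rpow_nonneg (le_max_right _ _) _
    · have := hmono h
      simp only [heq 1 le_rfl] at this
      exact (Real.rpow_nonneg (le_max_right _ _) _).trans this

/-- An entire radial solution of `-Δw = λ w₊ ^ p` with `w 0 = 1 = max w`. -/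
theorem exists_entire_solution (hN : N ≠ 0) (hp : 1 < p) {lam : ℝ} (hlam : 0 ≤ lam) :
    ∃ w : EuclideanSpace ℝ (Fin N) → ℝ, ContDiff ℝ 2 w ∧
      (∀ x, -lapl w x = lam * (max (w x) 0) ^ p) ∧ (∀ x, w x ≤ 1) ∧ w 0 = 1 ∧
      ∀ x y, ‖x‖ = ‖y‖ → w x = w y := by
  obtain ⟨F, F', hF, hF', hlip, hnn, heq⟩ := exists_truncation hp
  obtain ⟨n, rfl⟩ := Nat.exists_eq_succ_of_ne_zero hN
  obtain ⟨h, hh, h0, hle, hode⟩ := exists_radial_profile n (F := fun t => lam * F t)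
    (F' := fun t => lam * F' t) (L := lam * p) (by positivity) (fun t => (hF t).const_mul lam)
    (by fun_prop)
    (fun a b => by
      rw [← mul_sub, abs_mul, abs_of_nonneg hlam, mul_assoc]
      exact mul_le_mul_of_nonneg_left (hlip a b) hlam)
    (by rw [heq 0 zero_le_one, max_self, Real.zero_rpow (by linarith), mul_zero])
    (fun t => mul_nonneg hlam (hnn t)) 1
  refine ⟨fun x => h (‖x - 0‖ ^ 2), contDiff_radial hh 0, fun x => ?_,
    fun x => hle _ (sq_nonneg _), by simpa using h0, fun x y hxy => by simp [hxy]⟩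
  rw [lapl_radial hh, ← heq _ (hle _ (sq_nonneg _)), hode]
  ring

theorem exists_solution_of_pos (hN : N ≠ 0) (hp : 1 < p) (hpN : N * (p - 1) / 2 < p) {lam : ℝ}
    (hlam : 0 < lam) :
    ∃ (α : ℝ) (ψ : EuclideanSpace ℝ (Fin N) → ℝ), IsSol (DN N) p lam α ψ := by
  obtain ⟨w, hw, hl, hw1, hw0, hrad⟩ := exists_entire_solution (N := N) hN hp hlam.le
  have hwc := hw.continuous
  have hp0 : 0 < p := by linarith
  have : Nonempty (Fin N) := ⟨⟨0, Nat.pos_of_ne_zero hN⟩⟩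
  have hR := RN_pos hN
  set U : ℝ → EuclideanSpace ℝ (Fin N) → ℝ := fun a x => a * w (a ^ ((p - 1) / 2) • x) with hU
  have hUc : ∀ a, Continuous (U a) := fun a => by fun_prop
  set J : ℝ → ℝ := fun a => ∫ x in DN N, (max (U a x) 0) ^ p with hJ
  have hJc : Continuous J := by
    have h1 : Continuous fun a : ℝ => a ^ ((p - 1) / 2) :=
      continuous_id.rpow_const fun _ => Or.inr (by linarith)
    have h2 : Continuous (Function.uncurry fun (a : ℝ) (x : EuclideanSpace ℝ (Fin N)) =>
        (max (U a x) 0) ^ p) := by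
      simp only [Function.uncurry_def, hU]
      exact (continuous_max_rpow hp0.le).comp (by fun_prop)
    have h3 := continuous_parametric_integral_of_continuous
      (μ := (volume : Measure (EuclideanSpace ℝ (Fin N)))) h2 (isCompact_closedBall 0 (RN N))
    convert h3 using 2
    refine setIntegral_congr_set (ae_eq_of_subset_of_measure_ge ball_subset_closedBall
      (Measure.addHaar_closedBall_eq_addHaar_ball _ _ _).le measurableSet_ball.nullMeasurableSet
      measure_closedBall_lt_top.ne)
  have hU1 : U 1 = w := by
    funext x
    simp [hU]
  have hJ1 : J 1 ≤ 1 := by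
    have h1 : J 1 ≤ ∫ _ in DN N, (1 : ℝ) := by
      refine setIntegral_mono (integrableOn_ball ((continuous_max_rpow hp0.le).comp (hUc 1)) _)
        (integrableOn_const (by rw [volume_DN hN]; simp)) fun x => ?_
      rw [hU1]
      exact Real.rpow_le_one (le_max_right _ _) (max_le (hw1 x) zero_le_one) hp0.le
    simpa [Measure.real, volume_DN hN] using h1
  have hJpos : 0 < J 1 := by
    have hc : Continuous fun x => (max (w x) 0) ^ p := (continuous_max_rpow hp0.le).comp hwc
    simp only [hJ, hU1, DN]
    rw [setIntegral_pos_iff_support_of_nonneg_ae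
      (Eventually.of_forall fun x => Real.rpow_nonneg (le_max_right _ _) _)
      (integrableOn_ball hc _)]
    refine IsOpen.measure_pos _ (hc.isOpen_support.inter isOpen_ball) ⟨0, ?_, mem_ball_self hR⟩
    simp [hw0]
  set β : ℝ := p - N * (p - 1) / 2 with hβ
  have hβ0 : 0 < β := by linarith
  set b : ℝ := (1 / J 1) ^ (1 / β) with hb
  have hb1 : 1 ≤ b := Real.one_le_rpow ((one_le_div hJpos).2 hJ1) (by positivity)
  have hb0 : 0 < b := by linarith
  have hJb : 1 ≤ J b := by
    have h1 := integral_scaling_le (w := w) (u := U b) (p := p) (θ := b)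
      (κ := b ^ ((p - 1) / 2)) hp0 hb0 (Real.one_le_rpow hb1 (by linarith)) hR (hUc b)
      fun x _ => rfl
    rw [rpow_mul_inv_rpow_half_pow hb0, ← hβ, hb, ← Real.rpow_mul (by positivity),
      one_div_mul_cancel hβ0.ne', Real.rpow_one] at h1
    have h2 : 1 / J 1 * ∫ x in ball 0 (RN N), (max (w x) 0) ^ p = 1 := by
      have : ∫ x in ball 0 (RN N), (max (w x) 0) ^ p = J 1 := by
        simp only [hJ, hU1]
        rfl
      rw [this, one_div_mul_cancel hJpos.ne']
    rw [h2] at h1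
    exact h1
  obtain ⟨a, ha, hJa⟩ := intermediate_value_Icc hb1 hJc.continuousOn ⟨hJ1, hJb⟩
  have ha0 : 0 < a := by linarith [ha.1]
  have hUd : ContDiff ℝ 2 (U a) := by fun_prop
  have hUl : ∀ x, -lapl (U a) x = lam * (max (U a x) 0) ^ p := fun x => lapl_scaling hw ha0 (hl _)
  obtain ⟨z, hz⟩ := NormedSpace.sphere_nonempty (E := EuclideanSpace ℝ (Fin N)) (x := 0)
    (r := RN N) |>.2 hR.le
  have hkey : ∀ x, U a z + lam * (lam⁻¹ * (U a x - U a z)) = U a x := fun x => by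
    rw [mul_inv_cancel_left₀ hlam.ne']
    ring
  refine ⟨U a z, fun x => lam⁻¹ * (U a x - U a z), by fun_prop, fun x _ => ?_, fun x hx => ?_, ?_⟩
  · rw [hkey, lapl_const_mul _ (hUd.sub contDiff_const), lapl_sub hUd contDiff_const, lapl_const,
      sub_zero, ← mul_neg, hUl, inv_mul_cancel_left₀ hlam.ne']
  · rw [DN, frontier_ball _ hR.ne'] at hx
    have hxz : ‖x‖ = ‖z‖ := by
      rw [mem_sphere_zero_iff_norm.1 hx, mem_sphere_zero_iff_norm.1 hz]
    simp only [hU]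
    rw [hrad _ (a ^ ((p - 1) / 2) • z) (by rw [norm_smul, norm_smul, hxz]), sub_self, mul_zero]
  · simp only [hkey]
    exact hJa

theorem exists_solution_zero (hN : N ≠ 0) (p : ℝ) :
    ∃ (α : ℝ) (ψ : EuclideanSpace ℝ (Fin N) → ℝ), IsSol (DN N) p 0 α ψ := by
  have hR := RN_pos hN
  set q : ℝ → ℝ := fun s => (RN N ^ 2 - s) / (2 * N) with hq
  have hN0 : (N : ℝ) ≠ 0 := Nat.cast_ne_zero.2 hN
  have hqd : ContDiff ℝ 2 q := by fun_prop
  have hd : deriv q = fun _ => -1 / (2 * (N : ℝ)) := by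
    funext s
    have := ((hasDerivAt_id s).const_sub (RN N ^ 2)).div_const (2 * (N : ℝ))
    exact this.deriv
  refine ⟨1, fun x => q (‖x - 0‖ ^ 2), contDiff_radial hqd 0, fun x _ => ?_, fun x hx => ?_, ?_⟩
  · rw [lapl_radial hqd, hd]
    simp
    field_simp
  · rw [DN, frontier_ball _ hR.ne'] at hx
    simp [hq, mem_sphere_zero_iff_norm.1 hx]
  · simp [Measure.real, volume_DN hN]

end Existence

end Auxiliary

theorem stmt1 (N : ℕ) (hN : 2 ≤ N) (p : ℝ) (hp1 : 1 < p)
    (hpN : N = 2 ∨ p < (N : ℝ) / ((N : ℝ) - 2))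
    (lam : ℝ) (hlam : 0 ≤ lam) :
    (∃ (α : ℝ) (ψ : EuclideanSpace ℝ (Fin N) → ℝ), IsSol (DN N) p lam α ψ) ∧
    (∀ (α₁ α₂ : ℝ) (ψ₁ ψ₂ : EuclideanSpace ℝ (Fin N) → ℝ),
      IsSol (DN N) p lam α₁ ψ₁ → IsSol (DN N) p lam α₂ ψ₂ →
      α₁ = α₂ ∧ ∀ x ∈ closure (DN N), ψ₁ x = ψ₂ x) := by
  have hN0 : N ≠ 0 := by omega
  have hpN' : N * (p - 1) / 2 < p := by
    rcases eq_or_lt_of_le hN with h | h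
    · rw [← h]
      push_cast
      linarith
    · have h2 : (0 : ℝ) < N - 2 := by
        have : (2 : ℝ) < N := by exact_mod_cast h
        linarith
      have h3 := (lt_div_iff₀ h2).1 (hpN.resolve_left h.ne')
      linarith
  refine ⟨?_, fun _ _ _ _ h₁ h₂ => h₁.unique hN0 hp1 hpN' hlam h₂⟩
  rcases hlam.eq_or_lt with rfl | hpos
  · exact exists_solution_zero hN0 p
  · exact exists_solution_of_pos hN0 hp1 hpN' hpos

end
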